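/- (Wegner estimate for d ≥ 4.) Let d ≥ 4 and let V_hi be a hierarchical potential with barrier height h and well density N. For any 0 < β ≤ 1 there is h₀ = h₀(d) ≫ 1 such that if h > h₀ and α > N, then there exist q > 0, ε > 0 and a scale k_in (all depending only on h, β, α, d₀, N) such that for all k ≥ k_in and all E ∈ [−ι/2, 4d+β+ι/2]: ℙ( dist(Spec(H_Λ), E) < exp(−d_{k+1}^{1−ε}) ) ≤ d_{k+1}^{−q}, where Λ is either Λ̄_k or Λ̄_k^s (2 ≤ s ≤ N) and the probability is taken only over the Bernoulli variables ω(x) with x ∈ Λ. -/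

import Mathlib

noncomputable section

open scoped ENNReal

namespace HierABM

/-- Sites of the lattice `ℤ^d`. -/
abbrev Site (d : ℕ) := Fin d → ℤ

variable {d : ℕ}

/-- The `ℓ∞`-norm of a lattice site (as a natural number). -/
def linf (x : Site d) : ℕ := Finset.univ.sup fun i => (x i).natAbs

/-- The `ℓ∞`-distance between two lattice sites (as a natural number). -/
def linfDist (x y : Site d) : ℕ := Finset.univ.sup fun i => (x i - y i).natAbs

/-- The `ℓ¹`-distance between two lattice sites; `x ∼ y` means `l1dist x y = 1`. -/
def l1dist (x y : Site d) : ℤ := ∑ i, |x i - y i|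

/-- The `i`-th standard basis vector of `ℤ^d`. -/
def unit (i : Fin d) : Site d := fun j => if j = i then 1 else 0

/-- The discrete Laplacian `Δf(x) = ∑_{y ∼ x} f(y)`. -/
def discLap (f : Site d → ℝ) (x : Site d) : ℝ :=
  ∑ i : Fin d, (f (x + unit i) + f (x - unit i))

/-- The pointwise action of `H(ω) = 2d - Δ + V_hi + β ω`. -/
def hamAct (Vhi : Site d → ℝ) (β : ℝ) (ω : Site d → Bool)
    (f : Site d → ℝ) (x : Site d) : ℝ :=
  (2 * d + Vhi x + β * (if ω x then 1 else 0)) * f x - discLap f x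

/-- The Newtonian scales `d_k = d₀^(α^k)`, i.e. `d_{k+1} = d_k^α`. -/
def nscale (d₀ α : ℝ) (k : ℕ) : ℝ := d₀ ^ (α ^ k)

/-- The block `Λ_k(j) = {x : |x - j|_∞ ≤ 2⌊3 d_k⌋}`. -/
def LambdaS (d₀ α : ℝ) (k : ℕ) (j : Site d) : Set (Site d) :=
  {x | (linfDist x j : ℤ) ≤ 2 * ⌊3 * nscale d₀ α k⌋}

/-- `diam A ≤ r` in the `ℓ∞`-metric. -/
def diamLE (A : Set (Site d)) (r : ℤ) : Prop :=
  ∀ a ∈ A, ∀ b ∈ A, (linfDist a b : ℤ) ≤ r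

/-- `dist(A, B) ≥ r` in the `ℓ∞`-metric. -/
def setDistGE (A B : Set (Site d)) (r : ℝ) : Prop :=
  ∀ a ∈ A, ∀ b ∈ B, r ≤ (linfDist a b : ℝ)

/-- The potential with zero set `W` is `(k, N)`-hierarchical in `Λ_k(j)`. -/
def IsHierIn (d₀ α : ℝ) (N : ℕ) (W : Set (Site d)) : ℕ → Site d → Prop
  | 0, _ => True
  | 1, j => ∃ (m : ℕ) (C : Fin (m + 1) → Set (Site d)),
      m + 1 ≤ N ∧
      W ∩ LambdaS d₀ α 1 j = ⋃ s, C s ∧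
      (∀ s, diamLE (C s) (4 * ⌊3 * d₀⌋)) ∧
      C 0 ⊆ LambdaS d₀ α 0 j ∧
      (∀ s t, s ≠ t → setDistGE (C s) (C t) (2 * nscale d₀ α 1))
  | (k + 2), j => ∃ (m : ℕ) (C : Fin (m + 1) → Set (Site d)),
      m + 1 ≤ N ∧
      W ∩ LambdaS d₀ α (k + 2) j = ⋃ s, C s ∧
      C 0 ⊆ LambdaS d₀ α (k + 1) j ∧
      (∀ s t, s ≠ t → setDistGE (C s) (C t) (2 * nscale d₀ α (k + 2))) ∧
      IsHierIn d₀ α N W (k + 1) j ∧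
      (∀ s : Fin (m + 1), s ≠ 0 → ∃ js : Site d,
        LambdaS d₀ α (k + 1) js ⊆ LambdaS d₀ α (k + 2) j ∧
        C s ⊆ LambdaS d₀ α (k + 1) js ∧
        IsHierIn d₀ α N W (k + 1) js)

/-- `V_hi` is a hierarchical potential with scales `d₀, α`, well density `N`
and barrier height `h`. -/
def IsHierPot (d₀ α : ℝ) (N : ℕ) (h : ℝ) (Vhi : Site d → ℝ) : Prop :=
  (∀ x, Vhi x = 0 ∨ Vhi x = h) ∧
  ∀ k : ℕ, 1 ≤ k → IsHierIn d₀ α N {x | Vhi x = 0} k 0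

/-- The parameter `ι = min{1/100, (h - 4d - β)/2}`. -/
def iota (d : ℕ) (h β : ℝ) : ℝ := min (1 / 100) ((h - 4 * d - β) / 2)

/-- `ℙ` is the i.i.d. Bernoulli(1/2) product measure on `{0,1}^{ℤ^d}`. -/
def IsBernoulliProduct (d : ℕ) (ℙ : MeasureTheory.Measure (Site d → Bool)) : Prop :=
  ∀ (S : Finset (Site d)) (v : Site d → Bool),
    ℙ {ω | ∀ x ∈ S, ω x = v x} = (1 / 2 : ℝ≥0∞) ^ S.card

/-- The lattice box of (integer) radius `R` about `c`, as a finset. -/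
def boxF {d : ℕ} (c : Site d) (R : ℤ) : Finset (Site d) :=
  Fintype.piFinset fun i => Finset.Icc (c i - R) (c i + R)

/-- The block `Λ_k(j)` as a finset. -/
def LambdaF {d : ℕ} (d₀ α : ℝ) (k : ℕ) (j : Site d) : Finset (Site d) :=
  boxF j (2 * ⌊3 * nscale d₀ α k⌋)

/-- `Λ̄_k(j)`, the `(d_{k+1}/10)`-neighborhood of `Λ_k(j)`, as a finset. -/
def barLambdaF {d : ℕ} (d₀ α : ℝ) (k : ℕ) (j : Site d) : Finset (Site d) :=
  boxF j (2 * ⌊3 * nscale d₀ α k⌋ + ⌊nscale d₀ α (k + 1) / 10⌋)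

/-- The Dirichlet restriction `H_Λ = R_Λ H(ω) R_Λ` of `H(ω) = 2d - Δ + V_hi + βω`,
as a matrix indexed by `Λ`: its entries are `2d + V_hi(x) + βω(x)` on the diagonal and
`-1` between nearest neighbors. -/
def HMat {d : ℕ} (Vhi : Site d → ℝ) (β : ℝ) (ω : Site d → Bool) (Λ : Finset (Site d)) :
    Matrix Λ Λ ℝ := fun x y =>
  (if x = y then 2 * d + Vhi (x : Site d) + β * (if ω (x : Site d) then 1 else 0) else 0)
  - (if l1dist (x : Site d) (y : Site d) = 1 then 1 else 0)

/-! ### Abstract well models -/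

/-- A finite weighted graph with a potential which is large outside a set `W` of wells, a radial
function `ρ`, and a height function `τ` along which the eigenvalue equation can be swept. -/
structure WellModel (X : Type*) [Fintype X] where
  /-- The hopping weights. -/
  A : X → X → ℝ
  /-- The deterministic potential, with the energy subtracted. -/
  U : X → ℝ
  /-- The strength of the randomness. -/
  β : ℝ
  /-- The set of wells. -/
  W : Finset X
  /-- The distance to the center. -/
  ρ : X → ℕ
  /-- The height. -/
  τ : X → ℤ
  /-- The radius of a ball containing the wells. -/
  L : ℕ
  /-- The total radius. -/
  R : ℕ
  /-- An upper bound for the total hopping weight at a site. -/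
  D : ℝ
  /-- An upper bound for the total weight of the equation at a site. -/
  K : ℝ
  A_symm : ∀ x y, A x y = A y x
  A_nonneg : ∀ x y, 0 ≤ A x y
  A_row : ∀ x, ∑ y, A x y ≤ D
  A_rho : ∀ x y, A x y ≠ 0 → ρ y ≤ ρ x + 1
  β_pos : 0 < β
  β_le : β ≤ 1
  U_lower : ∀ x, x ∉ W → 2 * D + 2 ≤ U x
  U_bound : ∀ x, |U x| + β + D ≤ K
  W_rho : ∀ x ∈ W, ρ x ≤ L
  tau_le : ∀ x, τ x ≤ ρ x
  neg_tau_le : ∀ x, -τ x ≤ ρ x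
  D_ge : 1 ≤ D
  K_ge : 2 ≤ K
  up : ∀ x, τ x < R → ∃ z, τ z = τ x + 1 ∧ A z x = 1 ∧ ∀ y, A z y ≠ 0 → y ≠ x → τ x + 1 ≤ τ y

namespace WellModel

variable {X : Type*} [Fintype X] (S : WellModel X)

/-- The random potential. -/
def pot (ω : X → Bool) (x : X) : ℝ := S.U x + S.β * (if ω x then 1 else 0)

/-- The Schrödinger operator, with the energy subtracted. -/
def op (ω : X → Bool) : (X → ℝ) →ₗ[ℝ] (X → ℝ) where
  toFun f x := S.pot ω x * f x - ∑ y, S.A x y * f y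
  map_add' f g := by
    ext x
    simp only [Pi.add_apply, mul_add, Finset.sum_add_distrib]
    ring
  map_smul' t f := by
    ext x
    simp only [Pi.smul_apply, smul_eq_mul, RingHom.id_apply, mul_sub, Finset.mul_sum]
    congr 1
    · ring
    · exact Finset.sum_congr rfl fun y _ => by ring

lemma op_apply (ω : X → Bool) (f : X → ℝ) (x : X) :
    S.op ω f x = S.pot ω x * f x - ∑ y, S.A x y * f y := rfl

lemma U_le_pot (ω : X → Bool) (x : X) : S.U x ≤ S.pot ω x := by
  have := S.β_pos
  unfold pot
  split_ifs <;> linarith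

lemma abs_pot_le (ω : X → Bool) (x : X) : |S.pot ω x| + S.D ≤ S.K := by
  have h := S.U_bound x
  have hb := S.β_pos
  have : |S.pot ω x| ≤ |S.U x| + S.β := by
    refine (abs_add_le _ _).trans ?_
    gcongr
    split_ifs <;> simp [abs_of_pos hb, hb.le]
  linarith

lemma abs_hop_le {f : X → ℝ} {x : X} {s : ℝ} (hs : 0 ≤ s)
    (h : ∀ y, S.A x y ≠ 0 → |f y| ≤ s) : |∑ y, S.A x y * f y| ≤ S.D * s := by
  calc |∑ y, S.A x y * f y| ≤ ∑ y, |S.A x y * f y| := Finset.abs_sum_le_sum_abs _ _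
    _ ≤ ∑ y, S.A x y * s := by
        refine Finset.sum_le_sum fun y _ => ?_
        rw [abs_mul, abs_of_nonneg (S.A_nonneg x y)]
        by_cases hA : S.A x y = 0
        · simp [hA]
        · exact mul_le_mul_of_nonneg_left (h y hA) (S.A_nonneg x y)
    _ = (∑ y, S.A x y) * s := by rw [Finset.sum_mul]
    _ ≤ S.D * s := mul_le_mul_of_nonneg_right (S.A_row x) hs

lemma barrier_bound {ω : X → Bool} {f : X → ℝ} {x : X} {g s : ℝ} (hx : x ∉ S.W) (hs : 0 ≤ s)
    (hg : |S.op ω f x| ≤ g) (h : ∀ y, S.A x y ≠ 0 → |f y| ≤ s) :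
    (2 * S.D + 2) * |f x| ≤ g + S.D * s := by
  have h1 := S.abs_hop_le hs h
  have h2 : S.pot ω x * f x = S.op ω f x + ∑ y, S.A x y * f y := by rw [op_apply]; ring
  have h3 : 2 * S.D + 2 ≤ S.pot ω x := (S.U_lower x hx).trans (S.U_le_pot ω x)
  have hD := S.D_ge
  calc (2 * S.D + 2) * |f x| ≤ S.pot ω x * |f x| := by gcongr
    _ = |S.pot ω x * f x| := by rw [abs_mul, abs_of_nonneg (show 0 ≤ S.pot ω x by linarith)]
    _ ≤ |S.op ω f x| + |∑ y, S.A x y * f y| := by rw [h2]; exact abs_add_le _ _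
    _ ≤ g + S.D * s := add_le_add hg h1

/-- The maximum principle. -/
lemma abs_le_max {ω : X → Bool} {f : X → ℝ} {g b : ℝ} (hg : ∀ x ∉ S.W, |S.op ω f x| ≤ g)
    (hb : ∀ x ∈ S.W, |f x| ≤ b) (x : X) : |f x| ≤ max b (g / 2) := by
  obtain ⟨x₀, -, hx₀⟩ := Finset.exists_max_image Finset.univ (fun y => |f y|) ⟨x, Finset.mem_univ x⟩
  refine (hx₀ x (Finset.mem_univ x)).trans ?_
  by_cases hW : x₀ ∈ S.W
  · exact (hb x₀ hW).trans (le_max_left _ _)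
  · have h := S.barrier_bound hW (abs_nonneg (f x₀)) (hg x₀ hW) fun y _ => hx₀ y (Finset.mem_univ y)
    refine le_trans ?_ (le_max_right _ _)
    have hD := S.D_ge
    nlinarith [abs_nonneg (f x₀), mul_nonneg (by linarith : 0 ≤ S.D) (abs_nonneg (f x₀))]

lemma decay_outward {ω : X → Bool} {f : X → ℝ} {B : ℝ} (hf : ∀ x ∉ S.W, S.op ω f x = 0)
    (hB : ∀ x, |f x| ≤ B) (t : ℕ) (x : X) (hx : S.L + t ≤ S.ρ x) : |f x| ≤ B / 2 ^ t := by
  induction t generalizing x with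
  | zero => simpa using hB x
  | succ t ih =>
    have hW : x ∉ S.W := fun h => by have := S.W_rho x h; omega
    have hB0 : 0 ≤ B := (abs_nonneg _).trans (hB x)
    have h := S.barrier_bound (ω := ω) (g := 0) (s := B / 2 ^ t) hW (by positivity) (by simp [hf x hW])
      fun y hy => ih y (by have := S.A_rho y x (by rwa [S.A_symm]); omega)
    have hD := S.D_ge
    have h2 : 0 ≤ B / 2 ^ t := by positivity
    have h3 : B / 2 ^ (t + 1) = B / 2 ^ t / 2 := by rw [pow_succ]; field_simp
    rw [h3]
    nlinarith [abs_nonneg (f x)]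

lemma decay_inward {ω : X → Bool} {f : X → ℝ} {B : ℝ} {r : ℕ} (hW : ∀ x ∈ S.W, f x = 0)
    (hf : ∀ x ∉ S.W, S.ρ x ≤ r → S.op ω f x = 0)
    (hB : ∀ x, |f x| ≤ B) (t : ℕ) (x : X) (hx : S.ρ x + t ≤ r) : |f x| ≤ B / 2 ^ t := by
  induction t generalizing x with
  | zero => simpa using hB x
  | succ t ih =>
    have hB0 : 0 ≤ B := (abs_nonneg _).trans (hB x)
    by_cases hxW : x ∈ S.W
    · rw [hW x hxW, abs_zero]; positivity
    have h := S.barrier_bound (ω := ω) (g := 0) (s := B / 2 ^ t) hxW (by positivity)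
      (by simp [hf x hxW (by omega)])
      fun y hy => ih y (by have := S.A_rho x y hy; omega)
    have hD := S.D_ge
    have h2 : 0 ≤ B / 2 ^ t := by positivity
    have h3 : B / 2 ^ (t + 1) = B / 2 ^ t / 2 := by rw [pow_succ]; field_simp
    rw [h3]
    nlinarith [abs_nonneg (f x)]

/-- Sweeping the equation downwards: smallness above height `a` propagates to lower heights. -/
lemma sweep {ω : X → Bool} {f : X → ℝ} {a : ℤ} {s δ : ℝ} (ha : a ≤ S.R) (hδ : 0 ≤ δ) (hs0 : 0 ≤ s)
    (hf : ∀ x, |S.op ω f x| ≤ δ) (hs : ∀ x, a ≤ S.τ x → |f x| ≤ s) (n : ℕ) (x : X)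
    (hx : a ≤ S.τ x + n) : |f x| ≤ S.K ^ n * s + (S.K ^ n - 1) * δ := by
  have hK := S.K_ge
  induction n generalizing x with
  | zero => simpa using hs x (by simpa using hx)
  | succ n ih =>
    have hpow : 1 ≤ S.K ^ n := one_le_pow₀ (by linarith)
    set s' := S.K ^ n * s + (S.K ^ n - 1) * δ with hs'
    have hs'0 : 0 ≤ s' := by
      have := mul_nonneg (by linarith : 0 ≤ S.K ^ n - 1) hδ
      positivity
    have hmono : S.K * s' + δ ≤ S.K ^ (n + 1) * s + (S.K ^ (n + 1) - 1) * δ := by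
      rw [hs', pow_succ]
      nlinarith
    refine le_trans ?_ hmono
    by_cases hlow : a ≤ S.τ x + n
    · have := ih x hlow
      nlinarith
    obtain ⟨z, hz, hzA, hzy⟩ := S.up x (by push_cast at hx; omega)
    classical
    have hval : f x = S.pot ω z * f z - S.op ω f z - ∑ y, S.A z y * (if y = x then 0 else f y) := by
      have h1 : ∑ y, S.A z y * f y = f x + ∑ y, S.A z y * (if y = x then 0 else f y) := by
        have : ∀ y, S.A z y * f y
            = (if y = x then f x else 0) + S.A z y * (if y = x then 0 else f y) := by
          intro y
          by_cases h : y = x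
          · simp [h, hzA]
          · simp [h]
        rw [Finset.sum_congr rfl fun y _ => this y, Finset.sum_add_distrib]
        simp
      rw [op_apply, h1]
      ring
    have h2 : |∑ y, S.A z y * (if y = x then 0 else f y)| ≤ S.D * s' := by
      refine S.abs_hop_le hs'0 fun y hy => ?_
      split_ifs with h
      · simpa using hs'0
      · exact ih y (by have := hzy y hy h; push_cast at hx; omega)
    have h3 : |f z| ≤ s' := ih z (by push_cast at hx; omega)
    calc |f x| ≤ |S.pot ω z * f z| + |S.op ω f z|
          + |∑ y, S.A z y * (if y = x then 0 else f y)| := by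
          rw [hval]
          exact (abs_sub _ _).trans (add_le_add (abs_sub _ _) le_rfl)
      _ ≤ |S.pot ω z| * s' + δ + S.D * s' := by
          rw [abs_mul]
          gcongr
          exact hf z
      _ = (|S.pot ω z| + S.D) * s' + δ := by ring
      _ ≤ S.K * s' + δ := by
          gcongr
          exact S.abs_pot_le ω z

lemma exists_extension (ω : X → Bool) : ∃ e : (S.W → ℝ) →ₗ[ℝ] (X → ℝ),
    (∀ a (w : S.W), e a w = a w) ∧ ∀ a, ∀ x ∉ S.W, S.op ω (e a) x = 0 := by
  classical
  let T : (X → ℝ) →ₗ[ℝ] (X → ℝ) :=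
    { toFun := fun f x => if x ∈ S.W then f x else S.op ω f x
      map_add' := fun f g => by
        ext x
        by_cases h : x ∈ S.W <;> simp [h]
      map_smul' := fun t f => by
        ext x
        by_cases h : x ∈ S.W <;> simp [h] }
  have hT : Function.Injective T := by
    rw [← LinearMap.ker_eq_bot, LinearMap.ker_eq_bot']
    intro f hf
    have hf' : ∀ x, (if x ∈ S.W then f x else S.op ω f x) = 0 := fun x => congrFun hf x
    ext x
    have := S.abs_le_max (ω := ω) (f := f) (g := 0) (b := 0)
      (fun x hx => by have := hf' x; simp only [hx, if_false] at this; simp [this])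
      (fun x hx => by have := hf' x; simp only [hx, if_true] at this; simp [this]) x
    simpa using this
  let I : (S.W → ℝ) →ₗ[ℝ] (X → ℝ) :=
    { toFun := fun a x => if h : x ∈ S.W then a ⟨x, h⟩ else 0
      map_add' := fun f g => by
        ext x
        by_cases h : x ∈ S.W <;> simp [h]
      map_smul' := fun t f => by
        ext x
        by_cases h : x ∈ S.W <;> simp [h] }
  let T' := LinearEquiv.ofInjectiveEndo T hT
  have key : ∀ a x, (if x ∈ S.W then T'.symm (I a) x else S.op ω (T'.symm (I a)) x)
      = if h : x ∈ S.W then a ⟨x, h⟩ else 0 := fun a x =>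
    congrFun (show T (T'.symm (I a)) = I a from T'.apply_symm_apply (I a)) x
  refine ⟨T'.symm.toLinearMap ∘ₗ I, fun a w => ?_, fun a x hx => ?_⟩
  · have := key a w
    simpa using this
  · have := key a x
    simpa [hx] using this

/-- The extension of well data to a solution of the equation in the barrier. -/
def ext (ω : X → Bool) : (S.W → ℝ) →ₗ[ℝ] (X → ℝ) := (S.exists_extension ω).choose

lemma ext_well (ω : X → Bool) (a : S.W → ℝ) (w : S.W) : S.ext ω a w = a w :=
  (S.exists_extension ω).choose_spec.1 a w

lemma op_ext_barrier (ω : X → Bool) (a : S.W → ℝ) {x : X} (hx : x ∉ S.W) :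
    S.op ω (S.ext ω a) x = 0 :=
  (S.exists_extension ω).choose_spec.2 a x hx

lemma abs_ext_le (ω : X → Bool) (a : S.W → ℝ) (x : X) : |S.ext ω a x| ≤ ‖a‖ := by
  refine (S.abs_le_max (ω := ω) (g := 0) (b := ‖a‖) (fun x hx => ?_) (fun x hx => ?_) x).trans ?_
  · simp [S.op_ext_barrier ω a hx]
  · rw [S.ext_well ω a ⟨x, hx⟩]
    exact norm_le_pi_norm a ⟨x, hx⟩
  · simp

/-- The Schur complement (Feshbach map) on the wells. -/
def schur (ω : X → Bool) : (S.W → ℝ) →ₗ[ℝ] (S.W → ℝ) :=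
  (LinearMap.funLeft ℝ ℝ (Subtype.val : S.W → X)) ∘ₗ S.op ω ∘ₗ S.ext ω

lemma schur_apply (ω : X → Bool) (a : S.W → ℝ) (w : S.W) :
    S.schur ω a w = S.op ω (S.ext ω a) w := rfl

lemma abs_op_ext_le (ω : X → Bool) (a : S.W → ℝ) (x : X) :
    |S.op ω (S.ext ω a) x| ≤ ‖S.schur ω a‖ := by
  by_cases hx : x ∈ S.W
  · exact norm_le_pi_norm (S.schur ω a) ⟨x, hx⟩
  · simp [S.op_ext_barrier ω a hx]

/-- There are `m` independent well data that are `δ`-almost annihilated by the Schur complement. -/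
def HasCluster (ω : X → Bool) (m : ℕ) (δ : ℝ) : Prop :=
  ∃ V : Submodule ℝ (S.W → ℝ), Module.finrank ℝ V = m ∧ ∀ a ∈ V, ‖S.schur ω a‖ ≤ δ * ‖a‖

/-- Green's identity for two solutions in the barrier with different randomness. -/
lemma green (ω ω' : X → Bool) (f g : X → ℝ) :
    ∑ x, f x * S.op ω' g x - ∑ x, S.op ω f x * g x
      = ∑ x, (S.pot ω' x - S.pot ω x) * (f x * g x) := by
  have h : ∑ x, f x * ∑ y, S.A x y * g y = ∑ x, (∑ y, S.A x y * f y) * g x := by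
    simp only [Finset.mul_sum, Finset.sum_mul]
    rw [Finset.sum_comm]
    refine Finset.sum_congr rfl fun x _ => Finset.sum_congr rfl fun y _ => ?_
    rw [S.A_symm]
    ring
  simp only [op_apply, mul_sub, sub_mul, Finset.sum_sub_distrib]
  rw [h]
  have h1 : ∑ x, f x * (S.pot ω' x * g x) = ∑ x, S.pot ω' x * (f x * g x) :=
    Finset.sum_congr rfl fun x _ => by ring
  have h2 : ∑ x, S.pot ω x * f x * g x = ∑ x, S.pot ω x * (f x * g x) :=
    Finset.sum_congr rfl fun x _ => by ring
  rw [h1, h2]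
  ring

end WellModel

lemma exists_near_of_not_exists_larger {V : Type*} [NormedAddCommGroup V] [NormedSpace ℝ V]
    [FiniteDimensional ℝ V] (F : V →ₗ[ℝ] V) (P : Submodule ℝ V) {δ η : ℝ} (hδ : 0 ≤ δ)
    (hδη : 4 * δ ≤ η) (hP : ∀ v ∈ P, ‖F v‖ ≤ δ * ‖v‖)
    (hno : ¬ ∃ Q : Submodule ℝ V, Module.finrank ℝ Q = Module.finrank ℝ P + 1 ∧
      ∀ v ∈ Q, ‖F v‖ ≤ η * ‖v‖) (a : V) :
    ∃ p ∈ P, η * ‖a - p‖ ≤ 2 * ‖F (a - p)‖ ∧ ‖p‖ ≤ 2 * ‖a‖ := by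
  have : ProperSpace V := FiniteDimensional.proper ℝ V
  obtain ⟨p, hp, hdist⟩ := P.closed_of_finiteDimensional.exists_infDist_eq_dist
    ⟨0, P.zero_mem⟩ a
  have hmin : ∀ v ∈ P, ‖a - p‖ ≤ ‖a - v‖ := fun v hv => by
    rw [← dist_eq_norm, ← dist_eq_norm, ← hdist]
    exact Metric.infDist_le_dist_of_mem hv
  refine ⟨p, hp, ?_, ?_⟩
  · by_contra! hlt
    apply hno
    set b := a - p with hb
    have hmin' : ∀ v ∈ P, ∀ t : ℝ, |t| * ‖b‖ ≤ ‖v + t • b‖ := by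
      intro v hv t
      by_cases ht : t = 0
      · simp [ht]
      have h1 := hmin (p - t⁻¹ • v) (P.sub_mem hp (P.smul_mem _ hv))
      have h2 : a - (p - t⁻¹ • v) = t⁻¹ • (v + t • b) := by
        rw [smul_add, smul_smul, inv_mul_cancel₀ ht, one_smul, hb]
        abel
      rw [h2, norm_smul, norm_inv, Real.norm_eq_abs] at h1
      have h3 := mul_le_mul_of_nonneg_left h1 (abs_nonneg t)
      rwa [← mul_assoc, mul_inv_cancel₀ (abs_ne_zero.mpr ht), one_mul] at h3
    have hbP : b ∉ P := fun hbP => by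
      have h0 := hmin' (-b) (P.neg_mem hbP) 1
      have : ‖b‖ = 0 := le_antisymm (by simpa using h0) (norm_nonneg _)
      rw [this, mul_zero] at hlt
      exact absurd hlt (not_lt.mpr (by positivity))
    refine ⟨P ⊔ Submodule.span ℝ {b}, Submodule.finrank_sup_span_singleton hbP, fun u hu => ?_⟩
    obtain ⟨v, hv, w, hw, rfl⟩ := Submodule.mem_sup.mp hu
    obtain ⟨t, rfl⟩ := Submodule.mem_span_singleton.mp hw
    have h1 := hmin' v hv t
    have h2 : ‖v‖ ≤ ‖v + t • b‖ + |t| * ‖b‖ := by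
      have : v = (v + t • b) - t • b := by abel
      calc ‖v‖ = ‖(v + t • b) - t • b‖ := by rw [← this]
        _ ≤ ‖v + t • b‖ + ‖t • b‖ := norm_sub_le _ _
        _ = _ := by rw [norm_smul, Real.norm_eq_abs]
    calc ‖F (v + t • b)‖ = ‖F v + t • F b‖ := by simp
      _ ≤ ‖F v‖ + |t| * ‖F b‖ := by
          refine (norm_add_le _ _).trans ?_
          rw [norm_smul, Real.norm_eq_abs]
      _ ≤ δ * ‖v‖ + |t| * (η * ‖b‖ / 2) := by
          gcongr
          · exact hP v hv
          · linarith
      _ ≤ δ * (2 * ‖v + t • b‖) + η / 2 * ‖v + t • b‖ := by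
          have h4 : 0 ≤ η := by linarith
          have h5 : |t| * (η * ‖b‖ / 2) ≤ η / 2 * ‖v + t • b‖ := by
            calc |t| * (η * ‖b‖ / 2) = η / 2 * (|t| * ‖b‖) := by ring
              _ ≤ _ := by gcongr
          gcongr
          linarith
      _ ≤ η * ‖v + t • b‖ := by nlinarith [norm_nonneg (v + t • b)]
  · have h0 := hmin 0 P.zero_mem
    rw [sub_zero] at h0
    calc ‖p‖ = ‖a - (a - p)‖ := by congr 1; abel
      _ ≤ ‖a‖ + ‖a - p‖ := norm_sub_le _ _
      _ ≤ 2 * ‖a‖ := by linarith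

namespace WellModel

variable {X : Type*} [Fintype X] (S : WellModel X)

lemma op_sub_op (ω ω' : X → Bool) (f : X → ℝ) (x : X) :
    S.op ω f x - S.op ω' f x = (S.pot ω x - S.pot ω' x) * f x := by
  rw [op_apply, op_apply]
  ring

lemma pot_sub_pot (ω ω' : X → Bool) (x : X) : |S.pot ω x - S.pot ω' x| ≤ S.β := by
  have := S.β_pos
  unfold pot
  split_ifs <;> simp [abs_of_pos this, this.le]

lemma pot_congr {ω ω' : X → Bool} {x : X} (h : ω x = ω' x) : S.pot ω x = S.pot ω' x := by
  simp [pot, h]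

/-- If the configuration is changed only where a solution is at most `s`, the solution with the
same well data changes by at most `s / 2`. -/
lemma abs_ext_sub_ext_le {ω ω' : X → Bool} {r : ℕ} {s : ℝ} {a : S.W → ℝ} (hs : 0 ≤ s)
    (hω : ∀ x, S.ρ x ≤ r → ω x = ω' x) (hmax : ∀ x, r < S.ρ x → |S.ext ω' a x| ≤ s) (x : X) :
    |(S.ext ω a - S.ext ω' a) x| ≤ s / 2 := by
  refine (S.abs_le_max (ω := ω) (g := s) (b := 0) (fun y hy => ?_) (fun y hy => ?_) x).trans ?_
  · have h := S.op_sub_op ω ω' (S.ext ω' a) y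
    rw [S.op_ext_barrier ω' a hy, sub_zero] at h
    rw [map_sub, Pi.sub_apply, S.op_ext_barrier ω a hy, zero_sub, abs_neg, h, abs_mul]
    by_cases hr : S.ρ y ≤ r
    · rw [S.pot_congr (hω y hr)]
      simpa using hs
    · have h1 := (S.pot_sub_pot ω ω' y).trans S.β_le
      calc _ ≤ 1 * s := mul_le_mul h1 (hmax y (not_le.mp hr)) (abs_nonneg _) zero_le_one
        _ = s := one_mul s
  · have h1 := S.ext_well ω a ⟨y, hy⟩
    have h2 := S.ext_well ω' a ⟨y, hy⟩
    simp only at h1 h2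
    simp [h1, h2]
  · exact max_le (by positivity) le_rfl

lemma norm_schur_le {ω ω' : X → Bool} {r : ℕ} {s δ : ℝ} {a : S.W → ℝ} (hr : 1 ≤ r) (hs : 0 ≤ s)
    (hω : ∀ x, S.ρ x ≤ S.L + r → ω x = ω' x)
    (hmax : ∀ x, S.L + r < S.ρ x → |S.ext ω' a x| ≤ s)
    (ha : ‖S.schur ω' a‖ ≤ δ) : ‖S.schur ω a‖ ≤ δ + S.D * s / 2 ^ r := by
  have hδ : 0 ≤ δ := (norm_nonneg _).trans ha
  have hD : 0 ≤ S.D := by linarith [S.D_ge]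
  refine (pi_norm_le_iff_of_nonneg (by positivity)).mpr fun w => ?_
  set u := S.ext ω a - S.ext ω' a with hu
  have huW : ∀ x ∈ S.W, u x = 0 := fun x hx => by
    have h1 := S.ext_well ω a ⟨x, hx⟩
    have h2 := S.ext_well ω' a ⟨x, hx⟩
    simp only at h1 h2
    simp [hu, h1, h2]
  have hdecay := S.decay_inward (ω := ω) (f := u) (B := s / 2) (r := S.L + r) huW
    (fun x hx hρ => by
      have h := S.op_sub_op ω ω' (S.ext ω' a) x
      rw [S.op_ext_barrier ω' a hx, S.pot_congr (hω x hρ), sub_self, zero_mul, sub_zero] at h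
      rw [hu, map_sub, Pi.sub_apply, S.op_ext_barrier ω a hx, h, sub_zero])
    (S.abs_ext_sub_ext_le hs hω hmax) (r - 1)
  have hwL := S.W_rho w w.2
  have hsum : |∑ y, S.A w y * u y| ≤ S.D * (s / 2 / 2 ^ (r - 1)) :=
    S.abs_hop_le (by positivity) fun y hy => hdecay y (by have := S.A_rho w y hy; omega)
  have heq : S.schur ω a w = S.schur ω' a w - ∑ y, S.A w y * u y := by
    have h := S.op_sub_op ω ω' (S.ext ω' a) w
    rw [S.pot_congr (hω w (by omega)), sub_self, zero_mul] at h
    have h2 : S.op ω u w = S.op ω (S.ext ω a) w - S.op ω (S.ext ω' a) w := by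
      rw [hu, map_sub, Pi.sub_apply]
    rw [S.op_apply ω u w, huW w w.2, mul_zero, zero_sub] at h2
    rw [schur_apply, schur_apply]
    linarith
  have hpow : S.D * (s / 2 / 2 ^ (r - 1)) = S.D * s / 2 ^ r := by
    obtain ⟨t, rfl⟩ : ∃ t, r = t + 1 := ⟨r - 1, by omega⟩
    rw [Nat.add_sub_cancel, pow_succ]
    field_simp
  rw [heq, Real.norm_eq_abs]
  refine (abs_sub _ _).trans (add_le_add ?_ (hsum.trans hpow.le))
  exact (norm_le_pi_norm (S.schur ω' a) w).trans ha

/-- A cluster that cannot be enlarged contains a vector close to every approximate null vector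
of a configuration which agrees near the wells. -/
lemma exists_mem_cluster_near {ω ω' : X → Bool} {m r : ℕ} {s δ η : ℝ} {a : S.W → ℝ} {x : X}
    (hr : 1 ≤ r) (hω : ∀ x, S.ρ x ≤ S.L + r → ω x = ω' x)
    (hx : |S.ext ω' a x| = s) (hmax : ∀ y, S.L + r < S.ρ y → |S.ext ω' a y| ≤ s)
    (ha1 : ‖a‖ = 1) (ha : ‖S.schur ω' a‖ ≤ δ) (hη : 0 < η) (hs : 48 * δ ≤ η * s)
    (hηr : 16 * S.D ≤ η * 2 ^ r) (hno : ¬ S.HasCluster ω (m + 1) η) (hc : S.HasCluster ω m δ) :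
    ∃ p : S.W → ℝ, ‖p‖ ≤ 2 ∧ ‖S.schur ω p‖ ≤ 2 * δ ∧
      |S.ext ω p x - S.ext ω' a x| ≤ 3 / 4 * s := by
  obtain ⟨V, hV, hVδ⟩ := hc
  have hs0 : 0 ≤ s := hx ▸ abs_nonneg _
  have hs1 : s ≤ 1 := by rw [← hx, ← ha1]; exact S.abs_ext_le ω' a x
  have hδ : 0 ≤ δ := (norm_nonneg _).trans ha
  obtain ⟨p, hp, hpa, hp2⟩ := exists_near_of_not_exists_larger (S.schur ω) V (η := η) hδ
    (by nlinarith) hVδ (by rw [hV]; exact hno) a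
  rw [ha1, mul_one] at hp2
  have hFp : ‖S.schur ω p‖ ≤ 2 * δ := by nlinarith [hVδ p hp]
  refine ⟨p, hp2, hFp, ?_⟩
  have hFa := S.norm_schur_le hr hs0 hω hmax ha
  have hb : ‖S.schur ω (a - p)‖ ≤ δ + S.D * s / 2 ^ r + 2 * δ := by
    rw [map_sub]
    exact (norm_sub_le _ _).trans (add_le_add hFa hFp)
  have h1 : S.D * s / 2 ^ r ≤ η * s / 16 := by
    rw [div_le_div_iff₀ (by positivity) (by norm_num)]
    nlinarith
  have h2 : ‖a - p‖ ≤ s / 4 := by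
    refine le_of_mul_le_mul_left (a := η) ?_ hη
    nlinarith
  have h3 := S.abs_ext_sub_ext_le hs0 hω hmax x
  have h4 : S.ext ω p x - S.ext ω' a x
      = (S.ext ω a - S.ext ω' a) x - S.ext ω (a - p) x := by
    rw [map_sub, Pi.sub_apply, Pi.sub_apply]
    ring
  rw [h4]
  refine (abs_sub _ _).trans ?_
  have h5 := S.abs_ext_le ω (a - p) x
  linarith

/-- An approximate null vector is not too small at some site outside a given ball. -/
lemma exists_large_outside {ω : X → Bool} {r : ℕ} {δ : ℝ} {a : S.W → ℝ} (hR : S.L + r < S.R)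
    (ha1 : ‖a‖ = 1) (ha : ‖S.schur ω a‖ ≤ δ) (hδ : 4 * (δ * S.K ^ (2 * S.L + r + 1)) ≤ 1) :
    ∃ x, S.L + r < S.ρ x ∧ 1 ≤ 2 * S.K ^ (2 * S.L + r + 1) * |S.ext ω a x| := by
  by_contra! hlt
  set T := 2 * S.L + r + 1 with hT
  have hK : 1 ≤ S.K ^ T := one_le_pow₀ (by linarith [S.K_ge])
  have hδ0 : 0 ≤ δ := (norm_nonneg _).trans ha
  have hbound : ‖a‖ ≤ 3 / 4 := by
    refine (pi_norm_le_iff_of_nonneg (by norm_num)).mpr fun w => ?_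
    have h := S.sweep (ω := ω) (f := S.ext ω a) (a := S.L + r + 1) (s := 1 / (2 * S.K ^ T)) (δ := δ)
      (by exact_mod_cast hR) hδ0 (by positivity) (fun x => (S.abs_op_ext_le ω a x).trans ha)
      (fun x hx => by
        have h1 := hlt x (by have := S.tau_le x; omega)
        rw [le_div_iff₀ (by positivity)]
        linarith) T w
      (by
        have h1 := S.neg_tau_le w
        have h2 := S.W_rho w w.2
        push_cast [hT]
        omega)
    rw [S.ext_well] at h
    rw [Real.norm_eq_abs]
    have h2 : S.K ^ T * (1 / (2 * S.K ^ T)) = 1 / 2 := by field_simp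
    rw [h2] at h
    nlinarith
  linarith

/-- Given the configuration near the wells, there is a modification outside of the ball which
destroys a cluster. -/
lemma exists_mask {r r' m : ℕ} {η δ : ℝ} (hm : 1 ≤ m) (hr : 1 ≤ r) (hR : S.L + r < S.R)
    (hη : 0 < η) (hη1 : η ≤ 1) (hηr : 16 * S.D ≤ η * 2 ^ r)
    (hδη : 96 * δ * S.K ^ (2 * S.L + r + 1) ≤ η)
    (hr' : 2 * S.K ^ (2 * S.L + r + 1) < 2 ^ r')
    (hβ : 64 * S.K ^ (2 * (2 * S.L + r + 1)) *
      (8 * Fintype.card X * δ + 4 * Fintype.card X / 4 ^ r') < S.β)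
    (ω₀ : X → Bool)
    (hno : ∀ ω, (∀ x, S.ρ x ≤ S.L + r → ω x = ω₀ x) → ¬ S.HasCluster ω (m + 1) η) :
    ∃ v : X → Bool, (∀ x, S.ρ x ≤ S.L + r → v x = false) ∧
      ∀ ω ω', (∀ x, S.ρ x ≤ S.L + r → ω x = ω₀ x) →
        (∀ x, S.ρ x ≤ S.L + r' → ω' x = (ω x ^^ v x)) →
        S.HasCluster ω m δ → ¬ S.HasCluster ω' m δ := by
  classical
  set T := 2 * S.L + r + 1 with hT
  have hK1 : 1 ≤ S.K ^ T := one_le_pow₀ (by linarith [S.K_ge])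
  have hrr' : r ≤ r' := by
    by_contra! hlt
    have h1 : (2 : ℝ) ^ r' ≤ 2 ^ T := pow_le_pow_right₀ (by norm_num) (by omega)
    have h2 : (2 : ℝ) ^ T ≤ S.K ^ T := pow_le_pow_left₀ (by norm_num) S.K_ge T
    linarith
  by_cases hex : ∃ ω, (∀ x, S.ρ x ≤ S.L + r → ω x = ω₀ x) ∧ S.HasCluster ω m δ
  swap
  · exact ⟨fun _ => false, fun _ _ => rfl, fun ω ω' h _ hc => absurd ⟨ω, h, hc⟩ hex⟩
  obtain ⟨ωs, hωs, V, hVm, hVδ⟩ := hex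
  obtain ⟨a, haV, ha1⟩ : ∃ a ∈ V, ‖a‖ = 1 := by
    have hV : V ≠ ⊥ := fun h => by
      rw [h, finrank_bot] at hVm
      omega
    obtain ⟨b, hb, hb0⟩ := V.exists_mem_ne_zero_of_ne_bot hV
    refine ⟨‖b‖⁻¹ • b, V.smul_mem _ hb, ?_⟩
    rw [norm_smul, norm_inv, norm_norm, inv_mul_cancel₀ (norm_ne_zero_iff.mpr hb0)]
  have ha : ‖S.schur ωs a‖ ≤ δ := by simpa [ha1] using hVδ a haV
  have hδ0 : 0 ≤ δ := (norm_nonneg _).trans ha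
  obtain ⟨x₁, hx₁, hx₁s⟩ := S.exists_large_outside hR ha1 ha (by rw [← hT]; nlinarith)
  rw [← hT] at hx₁s
  obtain ⟨x, hxmem, hxmax⟩ := Finset.exists_max_image
    (Finset.univ.filter fun y => S.L + r < S.ρ y) (fun y => |S.ext ωs a y|) ⟨x₁, by simpa using hx₁⟩
  simp only [Finset.mem_filter, Finset.mem_univ, true_and] at hxmem hxmax
  set s := |S.ext ωs a x| with hs
  have hsK : 1 ≤ 2 * S.K ^ T * s :=
    hx₁s.trans (mul_le_mul_of_nonneg_left (hxmax x₁ hx₁) (by positivity))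
  have hs0 : 0 ≤ s := abs_nonneg _
  have hsη : 48 * δ ≤ η * s := by
    have : 96 * δ * S.K ^ T * s ≤ η * s := mul_le_mul_of_nonneg_right hδη hs0
    nlinarith
  have hxr' : S.ρ x ≤ S.L + r' := by
    by_contra! hlt
    have h1 := S.decay_outward (ω := ωs) (fun y hy => S.op_ext_barrier ωs a hy)
      (S.abs_ext_le ωs a) r' x hlt.le
    rw [ha1, ← hs, le_div_iff₀ (by positivity)] at h1
    nlinarith
  refine ⟨fun y => decide (y = x), fun y hy => ?_, fun ω ω' hω hω' hc hc' => ?_⟩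
  · simp only [decide_eq_false_iff_not]
    rintro rfl
    omega
  have hωx : ∀ y, S.ρ y ≤ S.L + r' → y ≠ x → ω' y = ω y := fun y hy hyx => by
    simp [hω' y hy, hyx]
  have hω'r : ∀ y, S.ρ y ≤ S.L + r → ω' y = ω₀ y := fun y hy => by
    rw [hωx y (by omega) (by rintro rfl; omega), hω y hy]
  obtain ⟨p, hp2, hpδ, hpx⟩ := S.exists_mem_cluster_near hr
    (fun y hy => (hω y hy).trans (hωs y hy).symm) rfl hxmax ha1 ha hη hsη hηr (hno ω hω) hc
  obtain ⟨p', hp2', hpδ', hpx'⟩ := S.exists_mem_cluster_near hr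
    (fun y hy => (hω'r y hy).trans (hωs y hy).symm) rfl hxmax ha1 ha hη hsη hηr
    (hno ω' hω'r) hc'
  rw [← hs] at hpx hpx'
  set f := S.ext ω p with hf
  set f' := S.ext ω' p' with hf'
  have hgreen := S.green ω ω' f f'
  have hf2 : ∀ y, |f y| ≤ 2 := fun y => (S.abs_ext_le ω p y).trans hp2
  have hf2' : ∀ y, |f' y| ≤ 2 := fun y => (S.abs_ext_le ω' p' y).trans hp2'
  have hL : |∑ y, f y * S.op ω' f' y - ∑ y, S.op ω f y * f' y| ≤ 8 * Fintype.card X * δ := by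
    have h1 : ∀ y, |f y * S.op ω' f' y| ≤ 4 * δ := fun y => by
      rw [abs_mul]
      calc _ ≤ 2 * (2 * δ) := mul_le_mul (hf2 y) ((S.abs_op_ext_le ω' p' y).trans hpδ')
            (abs_nonneg _) (by norm_num)
        _ = _ := by ring
    have h2 : ∀ y, |S.op ω f y * f' y| ≤ 4 * δ := fun y => by
      rw [abs_mul]
      calc _ ≤ 2 * δ * 2 := mul_le_mul ((S.abs_op_ext_le ω p y).trans hpδ) (hf2' y)
            (abs_nonneg _) (by linarith)
        _ = _ := by ring
    have h3 : |∑ y, f y * S.op ω' f' y| ≤ Fintype.card X * (4 * δ) := by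
      refine (Finset.abs_sum_le_sum_abs _ _).trans ((Finset.sum_le_sum fun y _ => h1 y).trans ?_)
      simp
    have h4 : |∑ y, S.op ω f y * f' y| ≤ Fintype.card X * (4 * δ) := by
      refine (Finset.abs_sum_le_sum_abs _ _).trans ((Finset.sum_le_sum fun y _ => h2 y).trans ?_)
      simp
    refine (abs_sub _ _).trans ?_
    linarith
  have hfar : |∑ y ∈ Finset.univ.erase x, (S.pot ω' y - S.pot ω y) * (f y * f' y)|
      ≤ 4 * Fintype.card X / 4 ^ r' := by
    have h1 : ∀ y ∈ Finset.univ.erase x,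
        |(S.pot ω' y - S.pot ω y) * (f y * f' y)| ≤ 4 / 4 ^ r' := fun y hy => by
      have hyx := Finset.ne_of_mem_erase hy
      by_cases hρ : S.ρ y ≤ S.L + r'
      · rw [S.pot_congr (hωx y hρ hyx), sub_self, zero_mul, abs_zero]
        positivity
      · have d1 := S.decay_outward (ω := ω) (fun y hy => S.op_ext_barrier ω p hy) hf2 r' y
          (by omega)
        have d2 := S.decay_outward (ω := ω') (fun y hy => S.op_ext_barrier ω' p' hy) hf2' r' y
          (by omega)
        rw [abs_mul, abs_mul]
        calc _ ≤ 1 * (2 / 2 ^ r' * (2 / 2 ^ r')) :=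
              mul_le_mul ((S.pot_sub_pot ω' ω y).trans S.β_le)
                (mul_le_mul d1 d2 (abs_nonneg _) (by positivity)) (by positivity) zero_le_one
          _ = 4 / 4 ^ r' := by
              rw [show (4 : ℝ) ^ r' = 2 ^ r' * 2 ^ r' by rw [← mul_pow]; norm_num]
              field_simp
              norm_num
    calc _ ≤ ∑ y ∈ Finset.univ.erase x, |(S.pot ω' y - S.pot ω y) * (f y * f' y)| :=
          Finset.abs_sum_le_sum_abs _ _
      _ ≤ ∑ y ∈ Finset.univ.erase x, (4 : ℝ) / 4 ^ r' := Finset.sum_le_sum h1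
      _ ≤ ∑ y : X, (4 : ℝ) / 4 ^ r' :=
          Finset.sum_le_sum_of_subset_of_nonneg (Finset.erase_subset _ _)
            fun _ _ _ => by positivity
      _ = _ := by simp; ring
  rw [hgreen, ← Finset.add_sum_erase _ _ (Finset.mem_univ x)] at hL
  have hpot : |S.pot ω' x - S.pot ω x| = S.β := by
    have h1 : ω' x = !ω x := by simp [hω' x hxr']
    have hb := S.β_pos
    unfold pot
    rw [h1]
    cases ω x <;> simp [abs_of_pos hb]
  have hffx : s ^ 2 / 16 ≤ |f x * f' x| := by
    have e1 : s / 4 ≤ |f x| := by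
      have := abs_sub_abs_le_abs_sub (S.ext ωs a x) (f x)
      rw [abs_sub_comm, ← hs] at this
      linarith
    have e2 : s / 4 ≤ |f' x| := by
      have := abs_sub_abs_le_abs_sub (S.ext ωs a x) (f' x)
      rw [abs_sub_comm, ← hs] at this
      linarith
    rw [abs_mul]
    calc s ^ 2 / 16 = s / 4 * (s / 4) := by ring
      _ ≤ _ := mul_le_mul e1 e2 (by positivity) (abs_nonneg _)
  have hmain : S.β * (s ^ 2 / 16) ≤ 8 * Fintype.card X * δ + 4 * Fintype.card X / 4 ^ r' := by
    have h1 : |(S.pot ω' x - S.pot ω x) * (f x * f' x)|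
        ≤ 8 * Fintype.card X * δ + 4 * Fintype.card X / 4 ^ r' := by
      have := abs_sub_abs_le_abs_add
        ((S.pot ω' x - S.pot ω x) * (f x * f' x))
        (∑ y ∈ Finset.univ.erase x, (S.pot ω' y - S.pot ω y) * (f y * f' y))
      linarith
    rw [abs_mul, hpot] at h1
    exact (mul_le_mul_of_nonneg_left hffx S.β_pos.le).trans h1
  have hs2 : 1 ≤ 4 * S.K ^ (2 * T) * s ^ 2 := by
    have : (1 : ℝ) ≤ (2 * S.K ^ T * s) ^ 2 := one_le_pow₀ hsK
    calc (1 : ℝ) ≤ (2 * S.K ^ T * s) ^ 2 := this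
      _ = 4 * S.K ^ (2 * T) * s ^ 2 := by rw [pow_mul']; ring
  have hKT : 0 < S.K ^ (2 * T) := by
    have := S.K_ge
    positivity
  have h1 := mul_le_mul_of_nonneg_left hmain (by positivity : 0 ≤ 64 * S.K ^ (2 * T))
  have h2 := mul_le_mul_of_nonneg_left hs2 S.β_pos.le
  nlinarith

end WellModel

namespace WellModel

variable {X : Type*} [Fintype X] (S : WellModel X)

lemma HasCluster.mono {S : WellModel X} {ω : X → Bool} {m : ℕ} {δ η : ℝ}
    (h : S.HasCluster ω m δ) (hδη : δ ≤ η) : S.HasCluster ω m η := by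
  obtain ⟨V, hV, hVδ⟩ := h
  exact ⟨V, hV, fun a ha => (hVδ a ha).trans (by gcongr)⟩

lemma HasCluster.le_card {S : WellModel X} {ω : X → Bool} {m : ℕ} {δ : ℝ}
    (h : S.HasCluster ω m δ) : m ≤ S.W.card := by
  obtain ⟨V, hV, -⟩ := h
  have := Submodule.finrank_le V
  rw [hV] at this
  simpa using this

lemma hasCluster_zero (ω : X → Bool) (δ : ℝ) : S.HasCluster ω 0 δ :=
  ⟨⊥, finrank_bot ℝ _, fun a ha => by simp [(Submodule.mem_bot ℝ).mp ha]⟩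

/-- An approximate eigenfunction yields a cluster. -/
lemma hasCluster_one {ω : X → Bool} {u : X → ℝ} {κ δ : ℝ} (hu : u ≠ 0) (hκ : |κ| ≤ 1)
    (hop : ∀ x, S.op ω u x = κ * u x) (hδ : |κ| * (1 + S.D) ≤ δ) : S.HasCluster ω 1 δ := by
  have hD := S.D_ge
  have hus : ∀ x, |u x| ≤ ‖u‖ := fun x => norm_le_pi_norm u x
  have hu0 : 0 < ‖u‖ := norm_pos_iff.mpr hu
  set a : S.W → ℝ := fun w => u w with ha
  have hopu : ∀ x, |S.op ω u x| ≤ |κ| * ‖u‖ := fun x => by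
    rw [hop, abs_mul]
    exact mul_le_mul_of_nonneg_left (hus x) (abs_nonneg _)
  have hua : ‖u‖ ≤ ‖a‖ := by
    have h := fun x => S.abs_le_max (ω := ω) (b := ‖a‖) (fun x _ => hopu x)
      (fun x hx => norm_le_pi_norm a ⟨x, hx⟩) x
    have h2 : ‖u‖ ≤ max ‖a‖ (|κ| * ‖u‖ / 2) :=
      (pi_norm_le_iff_of_nonneg (le_max_of_le_left (norm_nonneg _))).mpr h
    rcases le_max_iff.mp h2 with h3 | h3
    · exact h3
    · nlinarith
  have ha0 : a ≠ 0 := norm_pos_iff.mp (hu0.trans_le hua)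
  have hdiff : ∀ x, |(u - S.ext ω a) x| ≤ |κ| * ‖u‖ / 2 := fun x => by
    refine (S.abs_le_max (ω := ω) (g := |κ| * ‖u‖) (b := 0) (fun y hy => ?_) (fun y hy => ?_) x).trans
      (max_le (by positivity) le_rfl)
    · rw [map_sub, Pi.sub_apply, S.op_ext_barrier ω a hy, sub_zero]
      exact hopu y
    · have := S.ext_well ω a ⟨y, hy⟩
      simp only [ha] at this
      simp [ha, this]
  have hF : ‖S.schur ω a‖ ≤ δ * ‖a‖ := by
    have hδ0 : 0 ≤ δ := le_trans (by positivity) hδ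
    refine (pi_norm_le_iff_of_nonneg (by positivity)).mpr fun w => ?_
    have h1 : S.op ω (u - S.ext ω a) w = - ∑ y, S.A w y * (u - S.ext ω a) y := by
      rw [op_apply, Pi.sub_apply, S.ext_well ω a w]
      simp [ha]
    have h2 := S.abs_hop_le (x := (w : X)) (by positivity) fun y _ => hdiff y
    have h3 : S.schur ω a w = S.op ω u w - S.op ω (u - S.ext ω a) w := by
      rw [map_sub, Pi.sub_apply, schur_apply]
      ring
    rw [h3, h1, Real.norm_eq_abs, sub_neg_eq_add]
    refine (abs_add_le _ _).trans ((add_le_add (hopu w) h2).trans ?_)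
    calc |κ| * ‖u‖ + S.D * (|κ| * ‖u‖ / 2) ≤ |κ| * (1 + S.D) * ‖u‖ := by
          nlinarith [mul_nonneg (mul_nonneg (abs_nonneg κ) hu0.le) (by linarith : 0 ≤ S.D)]
      _ ≤ δ * ‖a‖ := mul_le_mul hδ hua (norm_nonneg _) hδ0
  refine ⟨Submodule.span ℝ {a}, finrank_span_singleton ha0, fun b hb => ?_⟩
  obtain ⟨t, rfl⟩ := Submodule.mem_span_singleton.mp hb
  rw [map_smul, norm_smul, norm_smul]
  calc ‖t‖ * ‖S.schur ω a‖ ≤ ‖t‖ * (δ * ‖a‖) := by gcongr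
    _ = _ := by ring

open Classical in
/-- The largest cluster for configurations that agree with `ω` in a ball. -/
def clusterSize (r : ℕ) (δ : ℝ) (ω : X → Bool) : ℕ :=
  Nat.findGreatest (fun m => ∃ ω', (∀ x, S.ρ x ≤ S.L + r → ω' x = ω x) ∧ S.HasCluster ω' m δ)
    S.W.card

lemma exists_hasCluster_clusterSize (r : ℕ) (δ : ℝ) (ω : X → Bool) :
    ∃ ω', (∀ x, S.ρ x ≤ S.L + r → ω' x = ω x) ∧ S.HasCluster ω' (S.clusterSize r δ ω) δ := by
  classical
  exact Nat.findGreatest_spec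
    (P := fun m => ∃ ω', (∀ x, S.ρ x ≤ S.L + r → ω' x = ω x) ∧ S.HasCluster ω' m δ)
    (Nat.zero_le _) ⟨ω, fun _ _ => rfl, S.hasCluster_zero ω δ⟩

lemma le_clusterSize {r m : ℕ} {δ : ℝ} {ω ω' : X → Bool}
    (h : ∀ x, S.ρ x ≤ S.L + r → ω' x = ω x) (hc : S.HasCluster ω' m δ) :
    m ≤ S.clusterSize r δ ω := by
  classical
  exact Nat.le_findGreatest hc.le_card ⟨ω', h, hc⟩

lemma clusterSize_le_card (r : ℕ) (δ : ℝ) (ω : X → Bool) : S.clusterSize r δ ω ≤ S.W.card := by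
  classical
  exact Nat.findGreatest_le _

lemma clusterSize_mono {r r' : ℕ} {δ η : ℝ} {ω ω' : X → Bool} (hr : r ≤ r') (hδη : δ ≤ η)
    (h : ∀ x, S.ρ x ≤ S.L + r → ω' x = ω x) : S.clusterSize r' δ ω' ≤ S.clusterSize r η ω := by
  obtain ⟨ω₁, h₁, hc⟩ := S.exists_hasCluster_clusterSize r' δ ω'
  exact S.le_clusterSize (fun x hx => (h₁ x (by omega)).trans (h x hx)) (hc.mono hδη)

/-- The weight of a cluster size. -/
def weight (m : ℕ) : ℕ := if m = 0 then 0 else 2 ^ m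

lemma weight_le (m : ℕ) : weight m ≤ 2 ^ m := by
  unfold weight
  split_ifs <;> simp

lemma weight_mono {m n : ℕ} (h : m ≤ n) : weight m ≤ weight n := by
  unfold weight
  split_ifs
  · simp
  · simp
  · omega
  · exact Nat.pow_le_pow_right (by norm_num) h

lemma weight_add_weight_le {a b m : ℕ} (ha : a ≤ m) (hb : b ≤ m) (h : m ≠ 0 → ¬ (a = m ∧ b = m)) :
    4 * (weight a + weight b) ≤ 6 * weight m := by
  rcases m with - | m
  · obtain rfl : a = 0 := by omega
    obtain rfl : b = 0 := by omega
    simp [weight]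
  have hm : weight (m + 1) = 2 * 2 ^ m := by simp [weight, pow_succ]; ring
  have hlow : ∀ c, c ≤ m → weight c ≤ 2 ^ m := fun c hc =>
    (weight_le c).trans (Nat.pow_le_pow_right (by norm_num) hc)
  have hall : ∀ c, c ≤ m + 1 → weight c ≤ 2 * 2 ^ m := fun c hc => hm ▸ weight_mono hc
  rw [hm]
  have h' := h (Nat.succ_ne_zero m)
  by_cases ham : a = m + 1
  · have := hlow b (by omega)
    have := hall a ha
    omega
  · have := hlow a (by omega)
    have := hall b hb
    omega

/-- The expected weight decreases by a constant factor when the radius grows. -/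
lemma sum_weight_le {r r' : ℕ} {η δ : ℝ} (hr : 1 ≤ r) (hrr' : r ≤ r') (hR : S.L + r < S.R)
    (hη : 0 < η) (hη1 : η ≤ 1) (hδη' : δ ≤ η) (hηr : 16 * S.D ≤ η * 2 ^ r)
    (hδη : 96 * δ * S.K ^ (2 * S.L + r + 1) ≤ η)
    (hr' : 2 * S.K ^ (2 * S.L + r + 1) < 2 ^ r')
    (hβ : 64 * S.K ^ (2 * (2 * S.L + r + 1)) *
      (8 * Fintype.card X * δ + 4 * Fintype.card X / 4 ^ r') < S.β) [DecidableEq X] :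
    4 * ∑ ω, weight (S.clusterSize r' δ ω) ≤ 3 * ∑ ω, weight (S.clusterSize r η ω) := by
  have hmask : ∀ ω₀ : X → Bool, ∃ v : X → Bool, (∀ x, S.ρ x ≤ S.L + r → v x = false) ∧
      ∀ ω, (∀ x, S.ρ x ≤ S.L + r → ω x = ω₀ x) →
        4 * (weight (S.clusterSize r' δ ω) + weight (S.clusterSize r' δ fun x => (ω x ^^ v x)))
          ≤ 6 * weight (S.clusterSize r η ω₀) := by
    intro ω₀
    by_cases hm : S.clusterSize r η ω₀ = 0
    · refine ⟨fun _ => false, fun _ _ => rfl, fun ω hω => ?_⟩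
      have h1 := S.clusterSize_mono hrr' hδη' hω
      simp only [Bool.xor_false]
      exact weight_add_weight_le h1 h1 fun h => absurd hm h
    obtain ⟨v, hv, hvc⟩ := S.exists_mask (m := S.clusterSize r η ω₀) (Nat.one_le_iff_ne_zero.mpr hm)
      hr hR hη hη1 hηr hδη hr' hβ ω₀
      fun ω hω hc => by have := S.le_clusterSize hω hc; omega
    refine ⟨v, hv, fun ω hω => ?_⟩
    have hω' : ∀ x, S.ρ x ≤ S.L + r → (ω x ^^ v x) = ω₀ x := fun x hx => by
      rw [hv x hx, Bool.xor_false, hω x hx]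
    refine weight_add_weight_le (S.clusterSize_mono hrr' hδη' hω)
      (S.clusterSize_mono hrr' hδη' hω') fun _ ⟨e1, e2⟩ => ?_
    obtain ⟨ω₁, h₁, hc₁⟩ := S.exists_hasCluster_clusterSize r' δ ω
    obtain ⟨ω₂, h₂, hc₂⟩ := S.exists_hasCluster_clusterSize r' δ fun x => (ω x ^^ v x)
    rw [e1] at hc₁
    rw [e2] at hc₂
    exact hvc ω₁ ω₂ (fun x hx => (h₁ x (by omega)).trans (hω x hx))
      (fun x hx => by rw [h₂ x hx, h₁ x hx]) hc₁ hc₂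
  choose v hv hvw using hmask
  let res : (X → Bool) → X → Bool := fun ω x => if S.ρ x ≤ S.L + r then ω x else false
  let σ : (X → Bool) → X → Bool := fun ω x => (ω x ^^ v (res ω) x)
  have hres : ∀ ω, res (σ ω) = res ω := fun ω => by
    ext x
    by_cases hx : S.ρ x ≤ S.L + r
    · change (if S.ρ x ≤ S.L + r then (ω x ^^ v (res ω) x) else false) =
        if S.ρ x ≤ S.L + r then ω x else false
      rw [hv _ x hx, Bool.xor_false]
    · simp [res, hx]
  have hσ : Function.Involutive σ := fun ω => by
    funext x
    change (σ ω x ^^ v (res (σ ω)) x) = ω x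
    rw [hres]
    simp [σ]
  have hsum : ∀ g : (X → Bool) → ℕ, ∑ ω, g (σ ω) = ∑ ω, g ω := fun g =>
    Equiv.sum_comp hσ.toPerm g
  have hpair : ∀ ω, 4 * (weight (S.clusterSize r' δ ω) + weight (S.clusterSize r' δ (σ ω)))
      ≤ 6 * weight (S.clusterSize r η ω) := fun ω => by
    refine (hvw (res ω) ω fun x hx => by simp [res, hx]).trans ?_
    exact Nat.mul_le_mul_left _ (weight_mono
      (S.clusterSize_mono le_rfl le_rfl fun x hx => by simp [res, hx]))
  have h := Finset.sum_le_sum fun ω (_ : ω ∈ Finset.univ) => hpair ω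
  rw [← Finset.mul_sum, ← Finset.mul_sum, Finset.sum_add_distrib,
    hsum fun ω => weight (S.clusterSize r' δ ω)] at h
  omega

open Classical in
/-- The number of configurations with an approximate null vector. -/
theorem card_hasCluster_le [Nonempty X] [DecidableEq X] {κ n : ℕ} (hK : S.K = 2 ^ κ)
    (hbig : 2 ^ 14 * Fintype.card X * S.D ≤ S.β * 2 ^ S.L)
    (hR : S.L + (8 * κ + 2) ^ n * S.L < S.R) :
    ((Finset.univ.filter fun ω : X → Bool =>
      S.HasCluster ω 1 (16 * S.D / 2 ^ ((8 * κ + 2) ^ n * S.L))).card : ℝ)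
      ≤ (3 / 4) ^ n * 2 ^ S.W.card * 2 ^ Fintype.card X := by
  have hD := S.D_ge
  have hβ := S.β_pos
  have hβ1 := S.β_le
  have hX : (1 : ℝ) ≤ Fintype.card X := by exact_mod_cast Fintype.card_pos
  have hL14 : 14 ≤ S.L := by
    have h1 : (2 : ℝ) ^ 14 ≤ 2 ^ S.L := by
      have h2 : (2 : ℝ) ^ 14 ≤ 2 ^ 14 * Fintype.card X * S.D := by nlinarith
      have h3 : S.β * 2 ^ S.L ≤ 1 * 2 ^ S.L := by gcongr
      linarith
    exact (pow_le_pow_iff_right₀ (by norm_num)).mp h1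
  set q := 8 * κ + 2 with hq
  have hstep : ∀ i < n, 4 * ∑ ω, weight (S.clusterSize (q ^ (i + 1) * S.L)
      (16 * S.D / 2 ^ (q ^ (i + 1) * S.L)) ω)
      ≤ 3 * ∑ ω, weight (S.clusterSize (q ^ i * S.L) (16 * S.D / 2 ^ (q ^ i * S.L)) ω) := by
    intro i hi
    have hLr : S.L ≤ q ^ i * S.L := Nat.le_mul_of_pos_left _ (by positivity)
    have hr' : q ^ (i + 1) * S.L = 8 * (κ * (q ^ i * S.L)) + 2 * (q ^ i * S.L) := by
      rw [pow_succ, hq]; ring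
    have hrn : q ^ i * S.L ≤ q ^ n * S.L :=
      Nat.mul_le_mul_right _ (Nat.pow_le_pow_right (by omega) hi.le)
    set r := q ^ i * S.L with hr
    rw [hr']
    set r' := 8 * (κ * r) + 2 * r with hr'def
    have hrr' : r ≤ r' := by omega
    have hT : κ * (2 * S.L + r + 1) ≤ 4 * (κ * r) := by
      calc κ * (2 * S.L + r + 1) ≤ κ * (4 * r) := Nat.mul_le_mul_left _ (by omega)
        _ = _ := by ring
    have hKT : S.K ^ (2 * S.L + r + 1) ≤ 2 ^ (4 * (κ * r)) := by
      rw [hK, ← pow_mul]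
      exact pow_le_pow_right₀ (by norm_num) hT
    have hKT2 : S.K ^ (2 * (2 * S.L + r + 1)) ≤ 2 ^ (8 * (κ * r)) := by
      rw [hK, ← pow_mul]
      exact pow_le_pow_right₀ (by norm_num) (by linarith)
    have hp : ∀ {a b : ℕ}, a ≤ b → (2 : ℝ) ^ a ≤ 2 ^ b := fun h =>
      pow_le_pow_right₀ (by norm_num) h
    have h16 : 16 * S.D ≤ 2 ^ r := by
      have h1 : S.β * 2 ^ S.L ≤ 1 * 2 ^ S.L := by gcongr
      have h2 := hp hLr
      have h3 : 16 * S.D ≤ 2 ^ 14 * Fintype.card X * S.D := by nlinarith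
      linarith
    apply S.sum_weight_le (by omega) hrr' (by omega)
    · positivity
    · rw [div_le_one (by positivity)]
      exact h16
    · gcongr
      norm_num
    · rw [div_mul_cancel₀ _ (by positivity)]
    · rw [mul_div_assoc', div_mul_eq_mul_div, div_le_div_iff₀ (by positivity) (by positivity)]
      have h1 : 96 * S.K ^ (2 * S.L + r + 1) * 2 ^ r ≤ 2 ^ r' := by
        have hKpos : 0 ≤ S.K ^ (2 * S.L + r + 1) := by rw [hK]; positivity
        calc 96 * S.K ^ (2 * S.L + r + 1) * 2 ^ r ≤ 2 ^ 7 * 2 ^ (4 * (κ * r)) * 2 ^ r := by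
              gcongr
              norm_num
          _ = 2 ^ (7 + 4 * (κ * r) + r) := by rw [pow_add, pow_add]
          _ ≤ 2 ^ r' := hp (by omega)
      calc _ = 16 * S.D * (96 * S.K ^ (2 * S.L + r + 1) * 2 ^ r) := by ring
        _ ≤ 16 * S.D * 2 ^ r' := by gcongr
    · calc 2 * S.K ^ (2 * S.L + r + 1) ≤ 2 * 2 ^ (4 * (κ * r)) := by gcongr
        _ = 2 ^ (4 * (κ * r) + 1) := by ring
        _ < 2 ^ r' := pow_lt_pow_right₀ (by norm_num) (by omega)
    · have h4 : 4 * (Fintype.card X : ℝ) / 4 ^ r' ≤ 4 * Fintype.card X * S.D / 2 ^ r' := by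
        have : (2 : ℝ) ^ r' ≤ 4 ^ r' := pow_le_pow_left₀ (by norm_num) (by norm_num) _
        calc 4 * (Fintype.card X : ℝ) / 4 ^ r' ≤ 4 * Fintype.card X / 2 ^ r' := by gcongr
          _ ≤ _ := by
            refine div_le_div_of_nonneg_right ?_ (by positivity)
            nlinarith
      have h5 : 8 * (Fintype.card X : ℝ) * (16 * S.D / 2 ^ r') + 4 * Fintype.card X / 4 ^ r'
          ≤ 132 * (Fintype.card X * S.D) / 2 ^ r' := by
        refine (add_le_add_right h4 _).trans (le_of_eq ?_)
        ring
      have hXD : 0 < Fintype.card X * S.D := by positivity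
      calc _ ≤ 64 * 2 ^ (8 * (κ * r)) * (132 * (Fintype.card X * S.D) / 2 ^ r') := by
            gcongr
        _ = 8448 * (Fintype.card X * S.D) * 2 ^ (8 * (κ * r)) / 2 ^ r' := by ring
        _ < 2 ^ 14 * (Fintype.card X * S.D) * 2 ^ (8 * (κ * r)) / 2 ^ r' := by
            gcongr
            norm_num
        _ ≤ S.β := by
            rw [div_le_iff₀ (by positivity)]
            calc 2 ^ 14 * (Fintype.card X * S.D) * 2 ^ (8 * (κ * r))
                = 2 ^ 14 * Fintype.card X * S.D * 2 ^ (8 * (κ * r)) := by ring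
              _ ≤ S.β * 2 ^ S.L * 2 ^ (8 * (κ * r)) := by gcongr
              _ = S.β * 2 ^ (S.L + 8 * (κ * r)) := by rw [pow_add]; ring
              _ ≤ S.β * 2 ^ r' := by
                  gcongr
                  · norm_num
                  · omega
  have hiter : ∀ i ≤ n, ((∑ ω, weight (S.clusterSize (q ^ i * S.L)
      (16 * S.D / 2 ^ (q ^ i * S.L)) ω) : ℕ) : ℝ)
      ≤ (3 / 4) ^ i * (2 ^ S.W.card * 2 ^ Fintype.card X) := by
    intro i
    induction i with
    | zero =>
      intro _
      rw [pow_zero (3 / 4 : ℝ), one_mul (2 ^ _ * _ : ℝ)]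
      have : ∑ ω, weight (S.clusterSize (q ^ 0 * S.L) (16 * S.D / 2 ^ (q ^ 0 * S.L)) ω)
          ≤ ∑ _ω : X → Bool, 2 ^ S.W.card := Finset.sum_le_sum fun ω _ => (weight_le _).trans
            (Nat.pow_le_pow_right (by norm_num) (S.clusterSize_le_card _ _ _))
      calc _ ≤ ((∑ _ω : X → Bool, 2 ^ S.W.card : ℕ) : ℝ) := Nat.cast_le.mpr this
        _ = _ := by simp [mul_comm]
    | succ i ih =>
      intro hi
      have h1 := ih (by omega)
      have h2 : (4 : ℝ) * ((∑ ω, weight (S.clusterSize (q ^ (i + 1) * S.L)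
          (16 * S.D / 2 ^ (q ^ (i + 1) * S.L)) ω) : ℕ) : ℝ)
          ≤ 3 * ((∑ ω, weight (S.clusterSize (q ^ i * S.L)
            (16 * S.D / 2 ^ (q ^ i * S.L)) ω) : ℕ) : ℝ) := by
        exact_mod_cast hstep i (by omega)
      rw [pow_succ (3 / 4 : ℝ)]
      linarith
  rw [mul_assoc]
  refine le_trans ?_ (hiter n le_rfl)
  rw [Nat.cast_le, Finset.card_filter]
  refine Finset.sum_le_sum fun ω _ => ?_
  split_ifs with h
  · have h1 := S.le_clusterSize (r := q ^ n * S.L) (fun x _ => rfl) h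
    calc 1 ≤ weight 1 := by simp [weight]
      _ ≤ _ := weight_mono h1
  · exact Nat.zero_le _

end WellModel

/-! ### Counting wells -/

lemma linfDist_le_iff {x c : Site d} {n : ℕ} : linfDist x c ≤ n ↔ ∀ i, |x i - c i| ≤ n := by
  simp only [linfDist, Finset.sup_le_iff, Finset.mem_univ, true_imp_iff]
  exact forall_congr' fun i => by rw [Int.abs_eq_natAbs, Nat.cast_le]

lemma mem_boxF {c x : Site d} {R : ℤ} (hR : 0 ≤ R) : x ∈ boxF c R ↔ (linfDist x c : ℤ) ≤ R := by
  lift R to ℕ using hR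
  rw [Nat.cast_le, linfDist_le_iff]
  simp only [boxF, Fintype.mem_piFinset, Finset.mem_Icc, abs_le]
  exact forall_congr' fun i => by omega

lemma card_boxF (c : Site d) (R : ℤ) : (boxF c R).card = (2 * R + 1).toNat ^ d := by
  have h : ∀ i, (Finset.Icc (c i - R) (c i + R)).card = (2 * R + 1).toNat := fun i => by
    rw [Int.card_Icc]
    congr 1
    ring
  simp [boxF, Fintype.card_piFinset, h, -Int.card_Icc]

lemma encard_le_of_diamLE {A : Set (Site d)} {r : ℤ} (h : diamLE A r) (hr : 0 ≤ r) :
    A.encard ≤ ((2 * r + 1).toNat ^ d : ℕ) := by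
  rcases A.eq_empty_or_nonempty with rfl | ⟨a, ha⟩
  · simp
  rw [← card_boxF a r, ← Set.encard_coe_eq_coe_finsetCard]
  exact Set.encard_le_encard fun x hx => (mem_boxF hr).mpr (h x hx a ha)

/-- The number of well sites in a hierarchical block. -/
lemma encard_wells_le {d₀ α : ℝ} (hd₀ : 1 < d₀) {N : ℕ} {W : Set (Site d)} (k : ℕ) (j : Site d)
    (h : IsHierIn d₀ α N W (k + 1) j) : (W ∩ LambdaS d₀ α (k + 1) j).encard ≤
      ((2 * (4 * ⌊3 * d₀⌋) + 1).toNat ^ d * N ^ (k + 1) : ℕ) := by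
  have hunion : ∀ (m : ℕ) (C : Fin (m + 1) → Set (Site d)) (B : ℕ), m + 1 ≤ N →
      (∀ s, (C s).encard ≤ B) → (⋃ s, C s).encard ≤ (N * B : ℕ) := fun m C B hm hC => by
    calc (⋃ s, C s).encard ≤ ∑ s, (C s).encard := Set.encard_iUnion_le_of_fintype _
      _ ≤ ∑ _s : Fin (m + 1), (B : ℕ∞) := Finset.sum_le_sum fun s _ => hC s
      _ = ((m + 1) * B : ℕ) := by simp
      _ ≤ _ := by exact_mod_cast Nat.mul_le_mul_right B hm
  induction k generalizing j with
  | zero =>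
    obtain ⟨m, C, hm, hW, hC, -, -⟩ := h
    rw [hW, zero_add, pow_one, mul_comm]
    exact hunion m C _ hm fun s => encard_le_of_diamLE (hC s) (by positivity)
  | succ k ih =>
    obtain ⟨m, C, hm, hW, hC0, -, hj, hC⟩ := h
    rw [hW, pow_succ, ← mul_assoc, mul_comm]
    refine hunion m C _ hm fun s => ?_
    have hCW : C s ⊆ W := (Set.subset_iUnion C s).trans (hW ▸ Set.inter_subset_left)
    by_cases hs : s = 0
    · subst hs
      exact (Set.encard_le_encard (Set.subset_inter hCW hC0)).trans (ih j hj)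
    · obtain ⟨js, -, hCs, hjs⟩ := hC s hs
      exact (Set.encard_le_encard (Set.subset_inter hCW hCs)).trans (ih js hjs)

/-! ### The lattice model -/

lemma l1dist_comm (x y : Site d) : l1dist x y = l1dist y x :=
  Finset.sum_congr rfl fun _ _ => abs_sub_comm _ _

lemma abs_sub_le_l1dist (x y : Site d) (i : Fin d) : |x i - y i| ≤ l1dist x y :=
  Finset.single_le_sum (f := fun i => |x i - y i|) (fun _ _ => abs_nonneg _) (Finset.mem_univ i)

lemma linfDist_self (x : Site d) : linfDist x x = 0 :=
  Nat.le_zero.mp (linfDist_le_iff.mpr (by simp))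

lemma linfDist_le_add_one {x y c : Site d} (h : l1dist x y = 1) :
    linfDist y c ≤ linfDist x c + 1 := by
  refine linfDist_le_iff.mpr fun i => ?_
  have h1 := abs_sub_le_l1dist x y i
  have h2 := linfDist_le_iff.mp (le_refl (linfDist x c)) i
  rw [h] at h1
  rw [abs_le] at *
  push_cast
  omega

lemma l1dist_add_unit (x : Site d) (i : Fin d) : l1dist (x + unit i) x = 1 := by
  have h : ∀ k, |(x + unit i) k - x k| = if k = i then 1 else 0 := fun k => by
    by_cases hk : k = i <;> simp [unit, hk]
  simp only [l1dist, h, Finset.sum_ite_eq', Finset.mem_univ, if_true]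

/-- The only neighbor of a site below it in a given direction is the obvious one. -/
lemma eq_of_l1dist_add_unit {x y : Site d} {i : Fin d} (h : l1dist (x + unit i) y = 1)
    (hi : y i < x i + 1) : y = x := by
  have hz : ∀ k, (x + unit i) k = x k + if k = i then 1 else 0 := fun k => rfl
  rw [l1dist, ← Finset.add_sum_erase _ _ (Finset.mem_univ i)] at h
  have h0 : 0 ≤ ∑ k ∈ Finset.univ.erase i, |(x + unit i) k - y k| :=
    Finset.sum_nonneg fun _ _ => abs_nonneg _
  have h1 : 1 ≤ |(x + unit i) i - y i| := by
    rw [hz, if_pos rfl]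
    exact le_trans (by omega) (le_abs_self _)
  have h2 : ∑ k ∈ Finset.univ.erase i, |(x + unit i) k - y k| = 0 := by omega
  rw [Finset.sum_eq_zero_iff_of_nonneg fun _ _ => abs_nonneg _] at h2
  funext k
  by_cases hk : k = i
  · subst hk
    have h3 : |(x + unit k) k - y k| = 1 := by omega
    rw [hz, if_pos rfl, abs_of_pos (by omega)] at h3
    omega
  · have h3 := abs_eq_zero.mp (h2 k (by simp [hk]))
    rw [hz, if_neg hk] at h3
    omega

lemma sum_neighbor_le (Λ : Finset (Site d)) (x : Site d) :
    ∑ y : Λ, (if l1dist x y = 1 then (1 : ℝ) else 0) ≤ 3 ^ d := by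
  rw [Finset.sum_coe_sort Λ fun y => if l1dist x y = 1 then (1 : ℝ) else 0, Finset.sum_boole]
  have h : (Λ.filter fun y => l1dist x y = 1) ⊆ boxF x 1 := fun y hy => by
    rw [mem_boxF zero_le_one]
    have h1 := (Finset.mem_filter.mp hy).2
    have h2 := linfDist_le_add_one (c := x) h1
    rw [linfDist_self] at h2
    omega
  calc _ ≤ ((boxF x 1).card : ℝ) := by exact_mod_cast Finset.card_le_card h
    _ = 3 ^ d := by rw [card_boxF]; norm_num [Int.toNat]

/-- The Dirichlet restriction of the Hamiltonian to a box as a well model. -/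
def latticeModel (Vhi : Site d → ℝ) {β : ℝ} (E : ℝ) (c : Site d) (i₀ : Fin d) {L R κ : ℕ}
    (hβ : 0 < β) (hβ1 : β ≤ 1) (hκ : 1 ≤ κ)
    (hlow : ∀ x ∈ boxF c R, Vhi x ≠ 0 → 2 * 3 ^ d + 2 ≤ 2 * d + Vhi x - E)
    (hK : ∀ x ∈ boxF c R, |2 * d + Vhi x - E| + β + 3 ^ d ≤ 2 ^ κ)
    (hW : ∀ x ∈ boxF c R, Vhi x = 0 → linfDist x c ≤ L) :
    WellModel (boxF c R) where
  A x y := if l1dist (x : Site d) (y : Site d) = 1 then 1 else 0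
  U x := 2 * d + Vhi x - E
  β := β
  W := Finset.univ.filter fun x => Vhi x = 0
  ρ x := linfDist (x : Site d) c
  τ x := (x : Site d) i₀ - c i₀
  L := L
  R := R
  D := 3 ^ d
  K := 2 ^ κ
  A_symm x y := by rw [l1dist_comm]
  A_nonneg x y := by split_ifs <;> norm_num
  A_row x := sum_neighbor_le _ _
  A_rho x y h := linfDist_le_add_one (by simpa using h)
  β_pos := hβ
  β_le := hβ1
  U_lower x hx := hlow x x.2 (by simpa using hx)
  U_bound x := hK x x.2
  W_rho x hx := hW x x.2 (by simpa using hx)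
  tau_le x := (le_abs_self _).trans (linfDist_le_iff.mp le_rfl i₀)
  neg_tau_le x := (neg_le_abs _).trans (linfDist_le_iff.mp le_rfl i₀)
  D_ge := one_le_pow₀ (by norm_num)
  K_ge := le_self_pow₀ (by norm_num) (by omega)
  up x hx := by
    refine ⟨⟨(x : Site d) + unit i₀, ?_⟩, ?_, ?_, ?_⟩
    · rw [mem_boxF (Int.natCast_nonneg R), Nat.cast_le, linfDist_le_iff]
      intro i
      have h1 := linfDist_le_iff.mp (Nat.cast_le.mp
        ((mem_boxF (Int.natCast_nonneg R)).mp x.2)) i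
      rw [abs_le] at *
      simp only [Pi.add_apply, unit]
      split_ifs with h
      · subst h; omega
      · omega
    · simp [unit]; ring
    · simp [l1dist_add_unit]
    · intro y hy hyx
      by_contra hlt
      exact hyx (Subtype.ext (eq_of_l1dist_add_unit (i := i₀) (by simpa using hy) (by omega)))

section Spectrum

open MeasureTheory

/-- An eigenvalue near `E` yields a cluster. -/
lemma hasCluster_of_mem_spectrum {Vhi : Site d → ℝ} {β E : ℝ} {c : Site d} {i₀ : Fin d} {L R κ : ℕ}
    (hβ : 0 < β) (hβ1 : β ≤ 1) (hκ : 1 ≤ κ)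
    (hlow : ∀ x ∈ boxF c R, Vhi x ≠ 0 → 2 * 3 ^ d + 2 ≤ 2 * d + Vhi x - E)
    (hK : ∀ x ∈ boxF c R, |2 * d + Vhi x - E| + β + 3 ^ d ≤ 2 ^ κ)
    (hW : ∀ x ∈ boxF c R, Vhi x = 0 → linfDist x c ≤ L)
    {ω : Site d → Bool} {t δ μ : ℝ} (hμ : μ ∈ spectrum ℝ (HMat Vhi β ω (boxF c R)))
    (hμt : |μ - E| ≤ t) (ht : t ≤ 1) (htδ : t * (1 + 3 ^ d) ≤ δ) :
    (latticeModel Vhi E c i₀ hβ hβ1 hκ hlow hK hW).HasCluster (fun x => ω x) 1 δ := by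
  rw [← Matrix.spectrum_toLin', ← Module.End.hasEigenvalue_iff_mem_spectrum] at hμ
  obtain ⟨u, hu, hu0⟩ := hμ.exists_hasEigenvector
  rw [Module.End.mem_eigenspace_iff, Matrix.toLin'_apply] at hu
  refine WellModel.hasCluster_one _ hu0 (κ := μ - E) (hμt.trans ht) (fun x => ?_)
    (le_trans (mul_le_mul_of_nonneg_right hμt (by simp only [latticeModel]; positivity)) htδ)
  have hx := congrFun hu x
  simp only [Matrix.mulVec, dotProduct, HMat, sub_mul, Finset.sum_sub_distrib, ite_mul, zero_mul,
    Finset.sum_ite_eq, Finset.mem_univ, if_true, Pi.smul_apply, smul_eq_mul] at hx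
  rw [WellModel.op_apply, sub_mul, ← hx]
  simp only [WellModel.pot, latticeModel, ite_mul, zero_mul]
  ring

/-- The Wegner estimate at finite scale, in terms of the number of well sites. -/
theorem measure_spectrum_le {ℙ : Measure (Site d → Bool)} (hℙ : IsBernoulliProduct d ℙ)
    {Vhi : Site d → ℝ} {β E : ℝ} (c : Site d) (i₀ : Fin d) {L R κ n M : ℕ}
    (hβ : 0 < β) (hβ1 : β ≤ 1) (hκ : 1 ≤ κ)
    (hlow : ∀ x ∈ boxF c R, Vhi x ≠ 0 → 2 * 3 ^ d + 2 ≤ 2 * d + Vhi x - E)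
    (hK : ∀ x ∈ boxF c R, |2 * d + Vhi x - E| + β + 3 ^ d ≤ 2 ^ κ)
    (hW : ∀ x ∈ boxF c R, Vhi x = 0 → linfDist x c ≤ L)
    (hbig : 2 ^ 14 * (2 * R + 1) ^ d * 3 ^ d ≤ β * 2 ^ L)
    (hR : L + (8 * κ + 2) ^ n * L < R)
    (hM : ((boxF c R).filter fun x => Vhi x = 0).card ≤ M) {t : ℝ} (ht : t ≤ 1)
    (htn : t * (1 + 3 ^ d) ≤ 16 * 3 ^ d / 2 ^ ((8 * κ + 2) ^ n * L)) :
    ℙ {ω | ∃ μ ∈ spectrum ℝ (HMat Vhi β ω (boxF c R)), |μ - E| < t} ≤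
      ENNReal.ofReal ((3 / 4) ^ n * 2 ^ M) := by
  classical
  set S := latticeModel Vhi E c i₀ hβ hβ1 hκ hlow hK hW
  have : Nonempty (boxF c R) :=
    ⟨c, (mem_boxF (Int.natCast_nonneg R)).mpr (by simp [linfDist_self])⟩
  have hcard : Fintype.card (boxF c R) = (2 * R + 1) ^ d := by
    rw [Fintype.card_coe, card_boxF]
    norm_cast
  have hWM : S.W.card ≤ M := by
    refine (Finset.card_le_card_of_injOn (fun x : boxF c R => (x : Site d)) (fun x hx => ?_)
      fun x _ y _ h => Subtype.ext h).trans hM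
    simpa [S, latticeModel] using hx
  set bad := Finset.univ.filter fun v : boxF c R → Bool =>
    S.HasCluster v 1 (16 * S.D / 2 ^ ((8 * κ + 2) ^ n * S.L)) with hbad
  have hbadc := S.card_hasCluster_le (κ := κ) (n := n) rfl
    (by rw [hcard]; push_cast; exact hbig) hR
  let e : (boxF c R → Bool) → Site d → Bool :=
    fun v x => if hx : x ∈ boxF c R then v ⟨x, hx⟩ else false
  have hsub : {ω | ∃ μ ∈ spectrum ℝ (HMat Vhi β ω (boxF c R)), |μ - E| < t} ⊆
      ⋃ v ∈ bad, {ω | ∀ x ∈ boxF c R, ω x = e v x} := by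
    rintro ω ⟨μ, hμ, hμt⟩
    refine Set.mem_biUnion (x := fun x : boxF c R => ω x) ?_ ?_
    · simp only [hbad, Finset.coe_filter, Finset.mem_univ, true_and, Set.mem_ofPred_eq]
      exact hasCluster_of_mem_spectrum hβ hβ1 hκ hlow hK hW hμ hμt.le ht htn
    · intro x hx
      simp [e, hx]
  calc _ ≤ ℙ (⋃ v ∈ bad, {ω | ∀ x ∈ boxF c R, ω x = e v x}) := measure_mono hsub
    _ ≤ ∑ v ∈ bad, ℙ {ω | ∀ x ∈ boxF c R, ω x = e v x} := measure_biUnion_finset_le _ _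
    _ = bad.card * (1 / 2 : ℝ≥0∞) ^ Fintype.card (boxF c R) := by
        rw [Finset.sum_congr rfl fun v _ => hℙ _ (e v), Finset.sum_const, nsmul_eq_mul,
          Fintype.card_coe]
    _ = ENNReal.ofReal (bad.card * (1 / 2) ^ Fintype.card (boxF c R)) := by
        rw [ENNReal.ofReal_mul (by positivity), ENNReal.ofReal_pow (by norm_num),
          ENNReal.ofReal_natCast]
        congr 2
        rw [ENNReal.ofReal_div_of_pos (by norm_num)]
        simp
    _ ≤ _ := by
        refine ENNReal.ofReal_le_ofReal ?_
        calc _ ≤ (3 / 4) ^ n * 2 ^ S.W.card * 2 ^ Fintype.card (boxF c R)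
              * (1 / 2 : ℝ) ^ Fintype.card (boxF c R) :=
              mul_le_mul_of_nonneg_right hbadc (by positivity)
          _ = (3 / 4) ^ n * 2 ^ S.W.card := by
              rw [mul_assoc _ (2 ^ _ : ℝ), ← mul_pow]
              norm_num
          _ ≤ _ := by gcongr; norm_num

end Spectrum

/-! ### Scales -/

lemma nscale_succ {d₀ α : ℝ} (hd₀ : 1 < d₀) (k : ℕ) :
    nscale d₀ α (k + 1) = nscale d₀ α k ^ α := by
  rw [nscale, nscale, ← Real.rpow_mul (by linarith), pow_succ]

lemma one_le_nscale {d₀ α : ℝ} (hd₀ : 1 < d₀) (hα : 1 < α) (k : ℕ) : 1 ≤ nscale d₀ α k :=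
  Real.one_le_rpow hd₀.le (by positivity)

lemma log_nscale {d₀ α : ℝ} (hd₀ : 1 < d₀) (k : ℕ) :
    Real.log (nscale d₀ α k) = α ^ k * Real.log d₀ :=
  Real.log_rpow (by linarith) _

lemma tendsto_nscale {d₀ α : ℝ} (hd₀ : 1 < d₀) (hα : 1 < α) :
    Filter.Tendsto (nscale d₀ α) Filter.atTop Filter.atTop :=
  (tendsto_rpow_atTop_of_base_gt_one d₀ hd₀).comp (tendsto_pow_atTop_atTop_of_one_lt hα)

/-- A logarithmic number of stages keeps the growth factor polynomial, while the probability
decays polynomially. -/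
lemma exists_stages {γ : ℝ} (hγ : 0 < γ) {b : ℕ} (hb : 2 ≤ b) : ∃ c : ℝ, 0 < c ∧
    ∀ y : ℝ, 1 ≤ y → ∃ n : ℕ, (b : ℝ) ^ n ≤ y ^ γ ∧ (3 / 4 : ℝ) ^ n ≤ 2 * y ^ (-c) := by
  have hb' : (2 : ℝ) ≤ b := by exact_mod_cast hb
  have hlogb : 0 < Real.log b := Real.log_pos (by linarith)
  have hlog : 0 < Real.log (4 / 3) := Real.log_pos (by norm_num)
  have hlog1 : Real.log (4 / 3) ≤ Real.log 2 := Real.log_le_log (by norm_num) (by norm_num)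
  refine ⟨γ / Real.log b * Real.log (4 / 3), by positivity, fun y hy => ?_⟩
  have hy0 : 0 < y := by linarith
  have hlogy : 0 ≤ Real.log y := Real.log_nonneg hy
  set s := γ / Real.log b * Real.log y with hs
  have hs0 : 0 ≤ s := by positivity
  refine ⟨⌊s⌋₊, ?_, ?_⟩
  · rw [← Real.log_le_log_iff (by positivity) (by positivity), Real.log_pow, Real.log_rpow hy0]
    calc (⌊s⌋₊ : ℝ) * Real.log b ≤ s * Real.log b := by gcongr; exact Nat.floor_le hs0
      _ = γ * Real.log y := by rw [hs]; field_simp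
  · rw [← Real.log_le_log_iff (by positivity) (by positivity), Real.log_pow,
      Real.log_mul (by norm_num) (by positivity), Real.log_rpow hy0,
      show (3 / 4 : ℝ) = (4 / 3)⁻¹ by norm_num, Real.log_inv]
    have h1 := (Nat.lt_floor_add_one s).le
    have h2 : s * Real.log (4 / 3) ≤ (⌊s⌋₊ + 1) * Real.log (4 / 3) := by gcongr
    have h3 : γ / Real.log b * Real.log (4 / 3) * Real.log y = s * Real.log (4 / 3) := by
      rw [hs]; ring
    linarith

lemma eventually_rpow_le_two_rpow (p C : ℝ) {b : ℝ} (hb : 0 < b) :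
    ∀ᶠ x : ℝ in Filter.atTop, C * x ^ p ≤ b * 2 ^ x := by
  have h := (isLittleO_rpow_exp_pos_mul_atTop p (Real.log_pos one_lt_two)).def
    (show 0 < b / (|C| + 1) by positivity)
  filter_upwards [h, Filter.eventually_ge_atTop 0] with x hx hx0
  rw [Real.norm_eq_abs, Real.norm_eq_abs, Real.abs_exp, abs_of_nonneg (by positivity)] at hx
  rw [Real.rpow_def_of_pos two_pos x]
  have h1 : 0 ≤ x ^ p := by positivity
  calc C * x ^ p ≤ (|C| + 1) * x ^ p := by gcongr; linarith [le_abs_self C]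
    _ ≤ (|C| + 1) * (b / (|C| + 1) * Real.exp (Real.log 2 * x)) := by gcongr
    _ = _ := by field_simp

lemma eventually_pow_le_pow {a b c : ℝ} (ha : 0 ≤ a) (hab : a < b) (C : ℝ) (hc : 0 < c) :
    ∀ᶠ k : ℕ in Filter.atTop, C * a ^ k ≤ c * b ^ k := by
  have hb : 0 < b := ha.trans_lt hab
  have h := (tendsto_pow_atTop_nhds_zero_of_lt_one (div_nonneg ha hb.le)
    ((div_lt_one hb).mpr hab)).const_mul C
  rw [mul_zero] at h
  filter_upwards [h.eventually_le_const hc] with k hk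
  rw [div_pow, mul_div_assoc', div_le_iff₀ (by positivity)] at hk
  exact hk

/-- The radius reached after the last stage. -/
lemma stage_radius_le {x y α γ : ℝ} {b n L : ℕ} (hα : 1 < α) (hx : 1 ≤ x) (hy : y = x ^ α)
    (hγ : γ = (1 - α⁻¹) / 4) (h6 : 6 ≤ y ^ γ) (hn : (b : ℝ) ^ n ≤ y ^ γ) (hL : (L : ℝ) ≤ 6 * x) :
    ((b ^ n * L : ℕ) : ℝ) ≤ y ^ (1 - 2 * γ) ∧ y ^ (1 - 2 * γ) < ⌊y / 10⌋ := by
  have hα' : α⁻¹ < 1 := inv_lt_one_of_one_lt₀ hα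
  have hα0 : 0 < α⁻¹ := by positivity
  have hy1 : 1 ≤ y := hy ▸ Real.one_le_rpow hx (by linarith)
  have hy0 : 0 < y := by linarith
  have hxy : x = y ^ (1 - 4 * γ) := by
    rw [hy, hγ, ← Real.rpow_mul (by linarith)]
    convert (Real.rpow_one x).symm using 2
    field_simp
    ring
  constructor
  · push_cast
    calc (b : ℝ) ^ n * L ≤ y ^ γ * (y ^ γ * y ^ (1 - 4 * γ)) := by
          gcongr
          rw [← hxy]
          exact hL.trans (by gcongr)
      _ = _ := by
          rw [← Real.rpow_add hy0, ← Real.rpow_add hy0]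
          ring_nf
  · have h1 : 1 ≤ y ^ (1 - 2 * γ) := Real.one_le_rpow hy1 (by linarith)
    have h2 : y = y ^ (1 - 2 * γ) * (y ^ γ * y ^ γ) := by
      rw [← Real.rpow_add hy0, ← Real.rpow_add hy0]
      ring_nf
      rw [Real.rpow_one]
    have h3 := Int.lt_floor_add_one (y / 10)
    have h4 : 36 ≤ y ^ γ * y ^ γ := by nlinarith
    nlinarith

open MeasureTheory in
/-- The Wegner estimate at a single scale. -/
lemma measure_spectrum_barLambdaF_le {ℙ : Measure (Site d → Bool)} (hℙ : IsBernoulliProduct d ℙ)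
    (i₀ : Fin d) {d₀ α h β E γ t : ℝ} {N k n κ : ℕ} {j : Site d} {Vhi : Site d → ℝ} (hd₀ : 1 < d₀)
    (hα : 1 < α) (hβ : 0 < β) (hβ1 : β ≤ 1) (hκ : 1 ≤ κ) (hE : -1 ≤ E) (hE' : E ≤ 4 * d + 2)
    (hh : 2 * 3 ^ d + 4 * d + 10 < h) (hκh : 2 * d + h + 3 + 3 ^ d ≤ 2 ^ κ)
    (hV : ∀ x, Vhi x = 0 ∨ Vhi x = h)
    (hj : IsHierIn d₀ α N {x | Vhi x = 0} (k + 1) j)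
    (hVΛ : ∀ x ∈ barLambdaF d₀ α (k + 1) j, x ∉ LambdaS d₀ α (k + 1) j → Vhi x = h)
    (hγ : γ = (1 - α⁻¹) / 4) (h6 : 6 ≤ nscale d₀ α (k + 2) ^ γ)
    (hn : ((8 * κ + 2 : ℕ) : ℝ) ^ n ≤ nscale d₀ α (k + 2) ^ γ)
    (hbig : 2 ^ 14 * (15 ^ d * 3 ^ d) * nscale d₀ α (k + 1) ^ (α * d) ≤
      β * 2 ^ nscale d₀ α (k + 1))
    (ht : t = Real.exp (-(nscale d₀ α (k + 2) ^ (1 - 2 * γ)))) :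
    ℙ {ω | ∃ μ ∈ spectrum ℝ (HMat Vhi β ω (barLambdaF d₀ α (k + 1) j)), |μ - E| < t} ≤
      ENNReal.ofReal ((3 / 4) ^ n *
        2 ^ ((2 * (4 * ⌊3 * d₀⌋) + 1).toNat ^ d * N ^ (k + 1))) := by
  classical
  set x := nscale d₀ α (k + 1) with hx
  set y := nscale d₀ α (k + 2) with hy
  have hx1 : 1 ≤ x := one_le_nscale hd₀ hα _
  have hyx : y = x ^ α := nscale_succ hd₀ _
  have hxy : x ≤ y := hyx ▸ Real.self_le_rpow_of_one_le hx1 hα.le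
  have hwells := encard_wells_le hd₀ k j hj
  have hL0 : 0 ≤ 2 * ⌊3 * x⌋ := mul_nonneg zero_le_two (Int.floor_nonneg.mpr (by linarith))
  have hg0 : 0 ≤ ⌊y / 10⌋ := Int.floor_nonneg.mpr (by linarith)
  obtain ⟨L, hL⟩ := Int.eq_ofNat_of_zero_le hL0
  obtain ⟨g, hg⟩ := Int.eq_ofNat_of_zero_le hg0
  have hbar : barLambdaF d₀ α (k + 1) j = boxF j ((L + g : ℕ) : ℤ) := by
    rw [barLambdaF, ← hx, ← hy, hL, hg, Nat.cast_add]
  have hmem : ∀ z, z ∈ LambdaS d₀ α (k + 1) j ↔ linfDist z j ≤ L := fun z => by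
    rw [LambdaS, Set.mem_ofPred_eq, ← hx, hL, Nat.cast_le]
  have hLr : (L : ℝ) = 2 * ⌊3 * x⌋ := by exact_mod_cast (congrArg (Int.cast : ℤ → ℝ) hL).symm
  have hgr : (g : ℝ) = ⌊y / 10⌋ := by exact_mod_cast (congrArg (Int.cast : ℤ → ℝ) hg).symm
  have hLx : (L : ℝ) ≤ 6 * x := by linarith [Int.floor_le (3 * x)]
  have hxL : x ≤ L := by linarith [Int.lt_floor_add_one (3 * x)]
  have hgy : (g : ℝ) ≤ y / 10 := hgr ▸ Int.floor_le _
  obtain ⟨hr1, hr2⟩ := stage_radius_le hα hx1 hyx hγ h6 hn hLx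
  rw [hbar] at hVΛ ⊢
  have h3d : (1 : ℝ) ≤ 3 ^ d := one_le_pow₀ (by norm_num)
  have hd0 : (0 : ℝ) ≤ d := by positivity
  refine measure_spectrum_le hℙ j i₀ (L := L) (κ := κ) hβ hβ1 hκ ?_ ?_ ?_ ?_ ?_ ?_ ?_ ?_
  · intro z _ hz
    rw [(hV z).resolve_left hz]
    linarith
  · intro z _
    have : |2 * d + Vhi z - E| ≤ 2 * d + h + 2 := by
      rw [abs_le]
      rcases hV z with hz | hz <;> rw [hz] <;> constructor <;> linarith
    linarith
  · intro z hz hz0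
    by_contra hlt
    have := hVΛ z hz fun hzΛ => hlt ((hmem z).mp hzΛ)
    linarith
  · have h1 : (2 * ((L + g : ℕ) : ℝ) + 1) ≤ 15 * y := by push_cast; linarith
    have h2 : x ^ (α * d) = y ^ d := by
      rw [Real.rpow_mul (by linarith), ← hyx, Real.rpow_natCast]
    calc (2 : ℝ) ^ 14 * (2 * ((L + g : ℕ) : ℝ) + 1) ^ d * 3 ^ d
        ≤ 2 ^ 14 * (15 * y) ^ d * 3 ^ d := by gcongr
      _ = 2 ^ 14 * (15 ^ d * 3 ^ d) * x ^ (α * d) := by rw [h2, mul_pow]; ring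
      _ ≤ β * 2 ^ x := hbig
      _ ≤ β * 2 ^ L := by
          rw [← Real.rpow_natCast]
          gcongr
          norm_num
  · have : (((8 * κ + 2) ^ n * L : ℕ) : ℝ) < g := hr1.trans_lt (hgr ▸ hr2)
    have : (8 * κ + 2) ^ n * L < g := by exact_mod_cast this
    omega
  · have hfin : ((((boxF j ((L + g : ℕ) : ℤ)).filter fun z => Vhi z = 0).card : ℕ) : ℕ∞) ≤
        ((2 * (4 * ⌊3 * d₀⌋) + 1).toNat ^ d * N ^ (k + 1) : ℕ) := by
      rw [← Set.encard_coe_eq_coe_finsetCard]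
      refine (Set.encard_le_encard fun z hz => ?_).trans hwells
      obtain ⟨hzb, hz0⟩ := Finset.mem_filter.mp (Finset.mem_coe.mp hz)
      refine ⟨hz0, ?_⟩
      by_contra hzΛ
      have := hVΛ z hzb hzΛ
      linarith
    exact_mod_cast hfin
  · rw [ht]
    exact Real.exp_le_one_iff.mpr (neg_nonpos.mpr (Real.rpow_nonneg (by linarith) _))
  · rw [le_div_iff₀ (by positivity), ht]
    have h1 : (2 : ℝ) ^ ((8 * κ + 2) ^ n * L) ≤ Real.exp (y ^ (1 - 2 * γ)) := by
      rw [← Real.rpow_natCast, Real.rpow_def_of_pos two_pos]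
      refine Real.exp_le_exp.mpr (le_trans ?_ hr1)
      have := Real.log_two_lt_d9
      have h0 : (0 : ℝ) ≤ ((8 * κ + 2) ^ n * L : ℕ) := by positivity
      nlinarith
    calc _ ≤ Real.exp (-(y ^ (1 - 2 * γ))) * (1 + 3 ^ d) * Real.exp (y ^ (1 - 2 * γ)) := by gcongr
      _ = 1 + 3 ^ d := by
          rw [mul_right_comm, ← Real.exp_add]
          simp
      _ ≤ _ := by linarith

open MeasureTheory in
/-- **Wegner estimate for `d ≥ 4`** (Theorem 4.1).

For `d ≥ 4` there is `h₀ = h₀(d) ≫ 1` such that if the barrier height satisfies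
`h > h₀` and the barrier width exponent satisfies `α > N` (the well density), then
there are `q, ε > 0` and a scale `k_in`, depending only on `h, β, α, d₀, N` (and `d`),
such that for every hierarchical potential, every `k ≥ k_in`, every level-`k` block
`Λ_k(j)` of the hierarchical structure (every center `j` such that `V_hi` is
`(k,N)`-hierarchical in `Λ_k(j)` and the annulus `Λ̄_k(j) ∖ Λ_k(j)` lies in the barrier;
this covers both `Λ̄_k` and the `Λ̄_k^s`) and every energy `E ∈ [-ι/2, 4d+β+ι/2]`, the
probability that `H_{Λ̄_k(j)}` has an eigenvalue within `exp(-d_{k+1}^{1-ε})` of `E`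
is at most `d_{k+1}^{-q}`. -/
theorem wegner_estimate_high_dim (d : ℕ) (hd : 4 ≤ d) :
    ∃ h₀ : ℝ, 4 * (d : ℝ) + 1 < h₀ ∧
      ∀ (d₀ α : ℝ), 1 < d₀ →
      ∀ N : ℕ, 1 ≤ N → (N : ℝ) < α →
      ∀ h : ℝ, h₀ < h →
      ∀ β : ℝ, 0 < β → β ≤ 1 →
      ∃ (q ε : ℝ) (kin : ℕ), 0 < q ∧ 0 < ε ∧ 0 < kin ∧
        ∀ Vhi : Site d → ℝ, IsHierPot d₀ α N h Vhi →
        ∀ ℙ : Measure (Site d → Bool), IsProbabilityMeasure ℙ → IsBernoulliProduct d ℙ →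
        ∀ k : ℕ, kin ≤ k →
        ∀ j : Site d, IsHierIn d₀ α N {x | Vhi x = 0} k j →
          (∀ x ∈ barLambdaF d₀ α k j, x ∉ LambdaS d₀ α k j → Vhi x = h) →
        ∀ E : ℝ, E ∈ Set.Icc (-(iota d h β) / 2) (4 * (d : ℝ) + β + iota d h β / 2) →
          ℙ {ω | ∃ μ ∈ spectrum ℝ (HMat Vhi β ω (barLambdaF d₀ α k j)),
              |μ - E| < Real.exp (-(nscale d₀ α (k + 1) ^ (1 - ε)))} ≤
            ENNReal.ofReal (nscale d₀ α (k + 1) ^ (-q)) := by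
  refine ⟨2 * 3 ^ d + 4 * d + 10, by linarith [pow_pos (zero_lt_three' ℝ) d], ?_⟩
  intro d₀ α hd₀ N hN hα h hh β hβ hβ1
  have hN1 : (1 : ℝ) ≤ N := by exact_mod_cast hN
  have hα1 : 1 < α := by linarith
  obtain ⟨κ, hκ⟩ := pow_unbounded_of_one_lt (2 * d + h + 3 + 3 ^ d : ℝ) one_lt_two
  have hκ' : 2 * d + h + 3 + 3 ^ d ≤ (2 : ℝ) ^ (κ + 1) :=
    hκ.le.trans (pow_le_pow_right₀ one_le_two (by omega))
  set γ := (1 - α⁻¹) / 4 with hγ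
  have hγ0 : 0 < γ := by linarith [inv_lt_one_of_one_lt₀ hα1]
  obtain ⟨c, hc, hstages⟩ := exists_stages hγ0 (b := 8 * (κ + 1) + 2) (by omega)
  set C := (2 * (4 * ⌊3 * d₀⌋) + 1).toNat ^ d with hC
  have hscale := (tendsto_nscale hd₀ hα1).comp (Filter.tendsto_add_atTop_nat 1)
  have hscale2 := (tendsto_nscale hd₀ hα1).comp (Filter.tendsto_add_atTop_nat 2)
  have hev6 := ((tendsto_rpow_atTop hγ0).comp hscale2).eventually_ge_atTop 6
  have hevbig := hscale.eventually
    (eventually_rpow_le_two_rpow (α * d) (2 ^ 14 * (15 ^ d * 3 ^ d)) hβ)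
  have hevN := eventually_pow_le_pow (by linarith) hα ((1 + C) * N)
    (show 0 < c / 2 * α ^ 2 * Real.log d₀ by have := Real.log_pos hd₀; positivity)
  obtain ⟨K, hK⟩ := Filter.eventually_atTop.mp (hev6.and (hevbig.and hevN))
  refine ⟨c / 2, 2 * γ, K + 1, by positivity, by positivity, by omega, ?_⟩
  intro Vhi hV ℙ _ hℙ k hk j hj hVΛ E hE
  obtain ⟨k, rfl⟩ : ∃ l, k = l + 1 := ⟨k - 1, by omega⟩
  obtain ⟨h6, hbig, hpow⟩ := hK k (by omega)
  have hιpos : 0 < iota d h β := by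
    refine lt_min (by norm_num) ?_
    have := pow_pos (zero_lt_three' ℝ) d
    linarith
  have hι : iota d h β ≤ 1 / 100 := min_le_left _ _
  have hy1 := one_le_nscale hd₀ hα1 (k + 2)
  obtain ⟨n, hn, hn'⟩ := hstages _ hy1
  refine (measure_spectrum_barLambdaF_le hℙ ⟨0, by omega⟩ hd₀ hα1 hβ hβ1 (κ := κ + 1) (by omega)
    (by linarith [hE.1]) (by linarith [hE.2]) hh hκ' hV.1 hj hVΛ hγ h6 hn hbig rfl).trans ?_
  refine ENNReal.ofReal_le_ofReal ?_
  set y := nscale d₀ α (k + 2) with hy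
  have hy0 : 0 < y := by linarith
  have hlogy : Real.log y = α ^ (k + 2) * Real.log d₀ := log_nscale hd₀ _
  have hNk : (1 : ℝ) ≤ N ^ (k + 1) := one_le_pow₀ hN1
  have hMy : ((1 + C * N ^ (k + 1) : ℕ) : ℝ) ≤ c / 2 * Real.log y := by
    push_cast
    calc (1 + C * N ^ (k + 1) : ℝ) ≤ (1 + C) * N * N ^ k := by
          rw [mul_assoc, ← pow_succ', add_mul]; linarith
      _ ≤ c / 2 * α ^ 2 * Real.log d₀ * α ^ k := hpow
      _ = _ := by rw [hlogy]; ring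
  have h2 : (2 : ℝ) ^ (1 + C * N ^ (k + 1)) ≤ y ^ (c / 2) := by
    rw [← Real.rpow_natCast, Real.rpow_def_of_pos two_pos, Real.rpow_def_of_pos hy0]
    refine Real.exp_le_exp.mpr ?_
    have := Real.log_two_lt_d9
    have h0 : (0 : ℝ) ≤ (1 + C * N ^ (k + 1) : ℕ) := by positivity
    nlinarith
  calc (3 / 4 : ℝ) ^ n * 2 ^ (C * N ^ (k + 1))
      ≤ 2 * y ^ (-c) * 2 ^ (C * N ^ (k + 1)) := by gcongr
    _ = y ^ (-c) * 2 ^ (1 + C * N ^ (k + 1)) := by rw [pow_add]; ring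
    _ ≤ y ^ (-c) * y ^ (c / 2) := by gcongr
    _ = y ^ (-(c / 2)) := by rw [← Real.rpow_add hy0]; ring_nf

end HierABM
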